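/- arXiv:0801.1483 — 3 statements merged into one kernel-verified Lean document; each statement's English description precedes it below -/
import Mathlib

section
/- Let G be a cyclically 4-edge-connected cubic graph and H a cycle of length 6 in G. Then either G - V(H) has a perfect matching, or G - V(H) is bipartite. -/
open SimpleGraph

/-- `G` has a perfect matching. -/
def HasPM (G : SimpleGraph V) : Prop := ∃ M : G.Subgraph, M.IsPerfectMatching

/-- `G` is cyclically `k`-edge-connected: no set of fewer than `k` edges
separates `G` into two parts each containing a cycle. -/
def CycEdgeConn (G : SimpleGraph V) (k : ℕ) : Prop :=
  ∀ D : Finset (Sym2 V), D.card < k →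
    ¬ ∃ A : Set V, (∀ a ∈ A, ∀ b ∉ A, ¬ (G.deleteEdges (↑D : Set (Sym2 V))).Adj a b) ∧
      ¬ (G.induce A).IsAcyclic ∧ ¬ (G.induce Aᶜ).IsAcyclic

/-- A finite nonempty forest has fewer edges than vertices. -/
lemma SimpleGraph.IsAcyclic.card_edgeFinset_lt {W : Type*} [Fintype W] [Nonempty W]
    {F : SimpleGraph W} [Fintype F.edgeSet] (hF : F.IsAcyclic) :
    F.edgeFinset.card < Fintype.card W := by
  classical
  obtain ⟨T, hFT, -, hT⟩ :=
    (connected_top (V := W)).exists_isTree_le_of_le_of_isAcyclic le_top hF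
  have hcard := hT.card_edgeFinset
  have hle : F.edgeFinset.card ≤ T.edgeFinset.card :=
    Finset.card_le_card (edgeFinset_mono hFT)
  omega

/-- A graph with a cycle inside `A` is not acyclic on `A`. -/
lemma SimpleGraph.Walk.IsCycle.not_isAcyclic_induce {V : Type*} {G : SimpleGraph V} {v : V}
    {c : G.Walk v v} (hc : c.IsCycle) {A : Set V} (hA : ∀ x ∈ c.support, x ∈ A) :
    ¬ (G.induce A).IsAcyclic := fun h =>
  h (c.induce A hA) (Walk.IsCycle.of_map (f := (Embedding.induce A).toHom) (by simpa using hc))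

/-- The number of edges with exactly one end in `K`. -/
noncomputable def cutSize {V : Type*} [Fintype V] (G : SimpleGraph V) (K : Finset V) : ℕ :=
  open Classical in ∑ k ∈ K, {w ∈ Kᶜ | G.Adj k w}.card

section

variable {V : Type*} [Fintype V] {G : SimpleGraph V}

open Classical in
lemma card_neighbors_add_card_neighbors_compl (hcubic : ∀ v : V, (G.neighborSet v).ncard = 3)
    (K : Finset V) (v : V) :
    {w ∈ K | G.Adj v w}.card + {w ∈ Kᶜ | G.Adj v w}.card = 3 := by
  rw [← hcubic v, ← Finset.card_union_of_disjoint, ← Finset.filter_union, Finset.union_compl,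
    ← Set.ncard_coe_finset]
  · congr 1
    ext w
    simp
  · exact Finset.disjoint_filter_filter disjoint_compl_right

open Classical in
lemma sum_card_neighbors_eq_twice_card_edges_induce {V : Type*} {G : SimpleGraph V}
    (K : Finset V) :
    ∑ k ∈ K, {w ∈ K | G.Adj k w}.card =
      2 * (G.induce (K : Set V)).edgeFinset.card := by
  rw [← sum_degrees_eq_twice_card_edges, ← Finset.sum_coe_sort]
  refine Finset.sum_congr rfl fun k _ => ?_
  rw [← card_neighborFinset_eq_degree, ← Finset.card_map (Function.Embedding.subtype _)]
  congr 1
  ext w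
  simp [and_comm]

open Classical in
lemma isAcyclic_of_cutSize_lt {k : ℕ} (hcyc : CycEdgeConn G k) {K : Finset V}
    (hK : cutSize G K < k) (hKc : ¬ (G.induce (K : Set V)ᶜ).IsAcyclic) :
    (G.induce (K : Set V)).IsAcyclic := by
  by_contra hacyc
  refine hcyc (K.biUnion fun a => {w ∈ Kᶜ | G.Adj a w}.image fun w => s(a, w)) ?_
    ⟨K, fun a ha b hb hab => ?_, hacyc, hKc⟩
  · exact (Finset.card_biUnion_le.trans
      (Finset.sum_le_sum fun a _ => Finset.card_image_le)).trans_lt hK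
  · rw [deleteEdges_adj] at hab
    refine hab.2 ?_
    simp only [Finset.coe_biUnion, Set.mem_iUnion]
    refine ⟨a, ha, ?_⟩
    simp only [Finset.coe_image, Set.mem_image]
    exact ⟨b, by simpa using ⟨hb, hab.1⟩, rfl⟩

/-- In a cyclically 4-edge-connected cubic graph, a nonempty set avoiding some cycle is either
a single vertex, with cut size 3, or has cut size at least 4. -/
lemma card_eq_one_or_four_le_cutSize (hcubic : ∀ v : V, (G.neighborSet v).ncard = 3)
    (hcyc : CycEdgeConn G 4) {K : Finset V} (hne : K.Nonempty)
    (hKc : ¬ (G.induce (K : Set V)ᶜ).IsAcyclic) :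
    K.card = 1 ∧ cutSize G K = 3 ∨ 4 ≤ cutSize G K := by
  classical
  refine or_iff_not_imp_right.2 fun hlt => ?_
  have hacyc := isAcyclic_of_cutSize_lt hcyc (not_le.1 hlt) hKc
  have : Nonempty (K : Set V) := hne.to_subtype
  have hedges := hacyc.card_edgeFinset_lt
  have hsum : ∑ k ∈ K, {w ∈ K | G.Adj k w}.card + cutSize G K = K.card * 3 := by
    rw [cutSize, ← Finset.sum_add_distrib,
      Finset.sum_congr rfl fun k _ => card_neighbors_add_card_neighbors_compl hcubic K k]
    simp
  rw [sum_card_neighbors_eq_twice_card_edges_induce] at hsum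
  have hcard : Fintype.card (K : Set V) = K.card := by simp
  have := hne.card_pos
  omega

open Classical in
/-- Suppose deleting `H ∪ X` leaves at least `|X| + 2` parts, every one of them either a single
vertex of cut size 3 or of cut size at least 4. If `H` sends out at most 6 edges, then `G - H` is
bipartite. -/
lemma colorable_two_of_parts (hcubic : ∀ v : V, (G.neighborSet v).ncard = 3)
    {H X : Finset V} (hHX : Disjoint H X) (hHcard : H.card = 6)
    (hHdeg : ∀ h ∈ H, 2 ≤ {w ∈ H | G.Adj h w}.card)
    {ι : Type*} [Fintype ι] (K : ι → Finset V)
    (hdisj : Pairwise fun i j => Disjoint (K i) (K j))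
    (hunion : Finset.univ.biUnion K = (H ∪ X)ᶜ)
    (hsep : ∀ i j, i ≠ j → ∀ a ∈ K i, ∀ b ∈ K j, ¬ G.Adj a b)
    (hcut : ∀ i, (K i).card = 1 ∧ cutSize G (K i) = 3 ∨ 4 ≤ cutSize G (K i))
    (hcard : X.card + 2 ≤ Fintype.card ι) :
    (G.induce {x | x ∉ H}).Colorable 2 := by
  set T := H ∪ X with hT
  have hmem : ∀ x, x ∉ T ↔ ∃ i, x ∈ K i := fun x => by
    rw [← Finset.mem_compl, ← hunion]; simp
  have hcutT : ∀ i, cutSize G (K i) = ∑ k ∈ K i, {w ∈ T | G.Adj k w}.card := fun i => by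
    refine Finset.sum_congr rfl fun k hk => congrArg _ ?_
    ext w
    simp only [Finset.mem_filter, Finset.mem_compl, and_congr_left_iff]
    refine fun hadj => ⟨fun hw => ?_, fun hw hwi => (hmem w).2 ⟨i, hwi⟩ hw⟩
    by_contra hwT
    obtain ⟨j, hj⟩ := (hmem w).1 hwT
    exact hsep i j (fun h => hw (h ▸ hj)) k hk w hj hadj
  have hcount : ∑ i, cutSize G (K i) = ∑ t ∈ T, {w ∈ Tᶜ | G.Adj t w}.card := by
    rw [Finset.sum_congr rfl fun i _ => hcutT i,
      ← Finset.sum_biUnion fun i _ j _ hij => hdisj hij, hunion]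
    have := Finset.sum_card_bipartiteAbove_eq_sum_card_bipartiteBelow (s := Tᶜ) (t := T) G.Adj
    simpa only [Finset.bipartiteAbove, Finset.bipartiteBelow, G.adj_comm] using this
  rw [hT, Finset.sum_union hHX, ← hT] at hcount
  have hsumH : ∑ h ∈ H, {w ∈ Tᶜ | G.Adj h w}.card ≤ 6 := by
    rw [← hHcard, Finset.card_eq_sum_ones]
    refine Finset.sum_le_sum fun h hh => ?_
    have h3 := card_neighbors_add_card_neighbors_compl hcubic T h
    have hle : {w ∈ H | G.Adj h w}.card ≤ {w ∈ T | G.Adj h w}.card :=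
      Finset.card_le_card (Finset.filter_subset_filter _ Finset.subset_union_left)
    have := hHdeg h hh
    omega
  have hX3 : ∀ x ∈ X, {w ∈ Tᶜ | G.Adj x w}.card ≤ 3 := fun x _ => by
    have h3 := card_neighbors_add_card_neighbors_compl hcubic T x
    omega
  have hK3 : ∀ i ∈ Finset.univ, 3 ≤ cutSize G (K i) := fun i _ => by
    have := hcut i
    omega
  have hsumX : ∑ x ∈ X, {w ∈ Tᶜ | G.Adj x w}.card ≤ X.card * 3 := by
    simpa using Finset.sum_le_sum hX3
  have hsumK : Fintype.card ι * 3 ≤ ∑ i, cutSize G (K i) := by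
    simpa using Finset.sum_le_sum hK3
  have hXindep : ∀ x ∈ X, ∀ y ∈ X, ¬ G.Adj x y := fun x hx y hy hxy => by
    have hlt : ∑ x ∈ X, {w ∈ Tᶜ | G.Adj x w}.card < ∑ _x ∈ X, 3 := by
      refine Finset.sum_lt_sum hX3 ⟨x, hx, ?_⟩
      have h3 := card_neighbors_add_card_neighbors_compl hcubic T x
      have hpos : 0 < {w ∈ T | G.Adj x w}.card :=
        Finset.card_pos.2 ⟨y, by simp [hT, hy, hxy]⟩
      omega
    rw [Finset.sum_const, smul_eq_mul] at hlt
    omega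
  have hKone : ∀ i, (K i).card = 1 := fun i => by
    refine ((hcut i).resolve_right fun h4 => ?_).1
    have hlt : ∑ _i : ι, 3 < ∑ i, cutSize G (K i) :=
      Finset.sum_lt_sum hK3 ⟨i, Finset.mem_univ i, h4⟩
    rw [Finset.sum_const, smul_eq_mul, Finset.card_univ] at hlt
    omega
  refine ⟨Coloring.mk (fun x => if (x : V) ∈ X then 0 else 1) ?_⟩
  rintro ⟨a, ha⟩ ⟨b, hb⟩ hab heq
  replace hab : G.Adj a b := hab
  rw [Set.mem_ofPred_eq] at ha hb
  by_cases haX : a ∈ X <;> by_cases hbX : b ∈ X <;> simp [haX, hbX] at heq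
  · exact hXindep a haX b hbX hab
  · obtain ⟨i, hi⟩ := (hmem a).1 (by simp [hT, ha, haX])
    obtain ⟨j, hj⟩ := (hmem b).1 (by simp [hT, hb, hbX])
    by_cases hij : i = j
    · subst hij
      exact hab.ne (Finset.card_le_one.1 (hKone i).le a hi b hj)
    · exact hsep i j hij a hi b hj hab

end

/-- A cubic graph has an even number of vertices. -/
lemma even_card_of_cubic {V : Type*} [Fintype V] {G : SimpleGraph V}
    (hcubic : ∀ v : V, (G.neighborSet v).ncard = 3) : Even (Fintype.card V) := by
  classical
  have hsum := G.sum_degrees_eq_twice_card_edges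
  have hdeg : ∀ v, G.degree v = 3 := fun v => by
    rw [← hcubic v, ← card_neighborSet_eq_degree, Set.ncard_eq_toFinset_card', Set.toFinset_card]
  simp only [hdeg, Finset.sum_const, Finset.card_univ, smul_eq_mul] at hsum
  rw [Nat.even_iff]
  omega

/-- The vertices of a cycle are as many as its edges. -/
lemma SimpleGraph.Walk.IsCycle.card_support_toFinset {V : Type*} [DecidableEq V]
    {G : SimpleGraph V} {v : V} {c : G.Walk v v} (hc : c.IsCycle) :
    c.support.toFinset.card = c.length := by
  have hmem : v ∈ c.support.tail := c.end_mem_tail_support hc.not_nil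
  rw [← c.cons_tail_support, List.toFinset_cons, Finset.insert_eq_of_mem (by simpa using hmem),
    List.toFinset_card_of_nodup hc.support_nodup]
  simp

/-- In a finite graph of even order without perfect matching, deleting some set `u` leaves at
least `|u| + 2` components. -/
lemma exists_ncard_add_two_le_card_components {W : Type*} [Fintype W] {F : SimpleGraph W}
    (heven : Even (Fintype.card W)) (hF : ¬ HasPM F) :
    ∃ u : Set W, u.ncard + 2 ≤ Nat.card ((⊤ : F.Subgraph).deleteVerts u).coe.ConnectedComponent := by
  classical
  rw [HasPM, tutte] at hF
  push Not at hF
  obtain ⟨u, hu⟩ := hF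
  refine ⟨u, ?_⟩
  rw [IsTutteViolator] at hu
  set L := ((⊤ : F.Subgraph).deleteVerts u).coe
  have hodd := L.odd_ncard_oddComponents
  have hle : L.oddComponents.ncard ≤ Nat.card L.ConnectedComponent := Set.ncard_le_card _
  have hverts : Nat.card ((⊤ : F.Subgraph).deleteVerts u).verts + u.ncard = Fintype.card W := by
    rw [← Nat.card_eq_fintype_card, ← Set.ncard_add_ncard_compl u, add_comm,
      Nat.card_coe_set_eq]
    congr 2
    ext x
    simp
  rw [Nat.odd_iff, Nat.odd_iff] at hodd
  rw [Nat.even_iff] at heven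
  omega

/-- in a cyclically 4-edge-connected cubic graph, for any 6-cycle `H`,
either `G - V(H)` has a perfect matching or `G - V(H)` is bipartite. -/
theorem sixCycle_central_or_bipartite [Fintype V] (G : SimpleGraph V)
    (hcubic : ∀ v : V, (G.neighborSet v).ncard = 3)
    (hcyc : CycEdgeConn G 4)
    (v : V) (c : G.Walk v v) (hc : c.IsCycle) (hlen : c.length = 6) :
    HasPM (G.induce {x | x ∉ c.support}) ∨
      (G.induce {x | x ∉ c.support}).Colorable 2 := by
  classical
  refine or_iff_not_imp_left.2 fun hPM => ?_
  have hHcard : c.support.toFinset.card = 6 := hc.card_support_toFinset.trans hlen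
  have heven : Even (Fintype.card {x | x ∉ c.support}) := by
    have hset : {x | x ∉ c.support} = ((c.support.toFinsetᶜ : Finset V) : Set V) := by
      ext x
      simp
    have hcardW : Fintype.card {x | x ∉ c.support} = Fintype.card V - 6 := by
      rw [← hHcard, ← Finset.card_compl, ← Nat.card_eq_fintype_card, Nat.card_coe_set_eq, hset,
        Set.ncard_coe_finset]
    have hV := even_card_of_cubic hcubic
    rw [hcardW]
    exact hV.tsub (by decide)
  obtain ⟨u, hu⟩ := exists_ncard_add_two_le_card_components heven hPM
  set L := ((⊤ : (G.induce {x | x ∉ c.support}).Subgraph).deleteVerts u).coe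
  let K : L.ConnectedComponent → Finset V := fun C =>
    C.supp.toFinset.image fun x => x.1.1
  have hmemK : ∀ C x, x ∈ K C ↔ ∃ (h : x ∉ c.support) (hx : (⟨x, h⟩ : {x | x ∉ c.support}) ∈
      ((⊤ : (G.induce {x | x ∉ c.support}).Subgraph).deleteVerts u).verts),
      L.connectedComponentMk ⟨⟨x, h⟩, hx⟩ = C := fun C x => by
    simp only [K, Finset.mem_image, Set.mem_toFinset, ConnectedComponent.mem_supp_iff]
    constructor
    · rintro ⟨⟨⟨y, hy⟩, hyu⟩, hyC, rfl⟩
      exact ⟨hy, hyu, hyC⟩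
    · rintro ⟨h, hx, hC⟩
      exact ⟨_, hC, rfl⟩
  have hcolor := colorable_two_of_parts hcubic (H := c.support.toFinset)
    (X := u.toFinset.image Subtype.val) ?_ hHcard ?_ K ?_ ?_ ?_ ?_ ?_
  · have hset : {x | x ∉ c.support.toFinset} = {x | x ∉ c.support} := by
      ext x
      simp
    rwa [hset] at hcolor
  · rw [Finset.disjoint_right]
    rintro x hx
    obtain ⟨y, -, rfl⟩ := Finset.mem_image.1 hx
    exact fun hy => y.2 (List.mem_toFinset.1 hy)
  · intro h hh
    rw [List.mem_toFinset] at hh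
    rw [← hc.ncard_neighborSet_toSubgraph_eq_two hh, ← Set.ncard_coe_finset]
    refine Set.ncard_le_ncard (fun w hw => ?_) (Set.toFinite _)
    have hw' : c.toSubgraph.Adj h w := hw
    simpa using ⟨c.mem_verts_toSubgraph.1 hw'.snd_mem, hw'.adj_sub⟩
  · intro C C' hne
    rw [Finset.disjoint_left]
    intro x hx hx'
    obtain ⟨_, _, hC⟩ := (hmemK C x).1 hx
    obtain ⟨_, _, hC'⟩ := (hmemK C' x).1 hx'
    exact hne (hC.symm.trans hC')
  · ext x
    simp only [Finset.mem_biUnion, Finset.mem_univ, true_and, hmemK]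
    simp only [exists_comm (α := L.ConnectedComponent), exists_eq']
    by_cases hx : x ∈ c.support <;> simp [hx]
  · intro C C' hne a ha b hb hab
    obtain ⟨ha, hau, hC⟩ := (hmemK C a).1 ha
    obtain ⟨hb, hbu, hC'⟩ := (hmemK C' b).1 hb
    refine hne (hC.symm.trans (Eq.trans ?_ hC'))
    refine ConnectedComponent.sound (Adj.reachable ?_)
    exact ⟨hau, hbu, hab⟩
  · intro C
    refine card_eq_one_or_four_le_cutSize hcubic hcyc ?_
      (hc.not_isAcyclic_induce fun x hx hxK => ((hmemK C x).1 hxK).1 hx)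
    simpa [K] using C.nonempty_supp
  · rw [Finset.card_image_of_injective _ Subtype.val_injective, ← Set.ncard_eq_toFinset_card',
      ← Nat.card_eq_fintype_card]
    exact hu
end

section
/- Every hexagonal face of a fullerene graph is resonant; that is, for every hexagonal face H of a fullerene graph F, there exists a perfect matching M of F such that the edges of H alternate between M and its complement. -/
open SimpleGraph

/-- The set of vertices incident with some edge of a face boundary. -/
def faceVerts (f : Finset (Sym2 V)) : Set V := {v | ∃ e ∈ f, v ∈ e}

/-- Number of odd connected components of `G`. -/
noncomputable def oddComponents (G : SimpleGraph V) : ℕ :=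
  Nat.card {c : G.ConnectedComponent // Odd (Nat.card c.supp)}

/-- A combinatorial fullerene: a cubic, 3-connected plane graph presented together with
its face boundaries (as edge sets of boundary cycles), every face a pentagon or a
hexagon, each edge on exactly two faces, Euler's formula, and exactly 12 pentagons. -/
structure IsFullerene [Fintype V] [DecidableEq V] (G : SimpleGraph V)
    (faces : Finset (Finset (Sym2 V))) : Prop where
  cubic : ∀ v : V, (G.neighborSet v).ncard = 3
  card_ge : 4 ≤ Fintype.card V
  threeConnected : ∀ s : Set V, s.ncard ≤ 2 → (G.induce sᶜ).Connected
  face_cycle : ∀ f ∈ faces, ∃ (v : V) (c : G.Walk v v), c.IsCycle ∧ c.edges.toFinset = f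
  face_size : ∀ f ∈ faces, f.card = 5 ∨ f.card = 6
  edge_two_faces : ∀ e ∈ G.edgeSet, (faces.filter (fun f => e ∈ f)).card = 2
  euler : Fintype.card V + faces.card = G.edgeSet.ncard + 2
  pentagons : (faces.filter (fun f => f.card = 5)).card = 12
/-- The face `f` is `M`-alternating: every vertex of `f` is matched by `M`
along an edge of `f`. -/
def AltFace (G : SimpleGraph V) (M : G.Subgraph) (f : Finset (Sym2 V)) : Prop :=
  ∀ v ∈ faceVerts f, ∃ u, s(v, u) ∈ f ∧ M.Adj v u

open scoped Finset

section Cuts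

variable {V : Type*} [Fintype V]

open scoped Classical in
/-- The edges of `G` as a finset. -/
noncomputable def edgesOf (G : SimpleGraph V) : Finset (Sym2 V) := {e | e ∈ G.edgeSet}

theorem mem_edgesOf {G : SimpleGraph V} {e : Sym2 V} : e ∈ edgesOf G ↔ e ∈ G.edgeSet := by
  simp [edgesOf]

theorem mk_mem_edgesOf {G : SimpleGraph V} {a b : V} : s(a, b) ∈ edgesOf G ↔ G.Adj a b := by
  simp [edgesOf]

variable [DecidableEq V] (G : SimpleGraph V)

open scoped Classical in
/-- The edges of `G` with exactly one end in `X`. -/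
noncomputable def cutEdges (X : Finset V) : Finset (Sym2 V) :=
  {e ∈ edgesOf G | ∃ a ∈ X, ∃ b ∉ X, e = s(a, b)}

/-- The edges of `G` with both ends in `X`. -/
noncomputable def insideEdges (X : Finset V) : Finset (Sym2 V) :=
  {e ∈ edgesOf G | ∀ a ∈ e, a ∈ X}

variable {G}

theorem mk_mem_cutEdges {X : Finset V} {a b : V} :
    s(a, b) ∈ cutEdges G X ↔ G.Adj a b ∧ (a ∈ X ∧ b ∉ X ∨ b ∈ X ∧ a ∉ X) := by
  simp only [cutEdges, Finset.mem_filter, mk_mem_edgesOf, Sym2.eq_iff]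
  grind

theorem mk_mem_insideEdges {X : Finset V} {a b : V} :
    s(a, b) ∈ insideEdges G X ↔ G.Adj a b ∧ a ∈ X ∧ b ∈ X := by
  simp [insideEdges, mk_mem_edgesOf]

theorem cutEdges_subset (X : Finset V) : cutEdges G X ⊆ edgesOf G := Finset.filter_subset _ _

theorem insideEdges_subset (X : Finset V) : insideEdges G X ⊆ edgesOf G :=
  Finset.filter_subset _ _

theorem disjoint_insideEdges_cutEdges (X : Finset V) :
    Disjoint (insideEdges G X) (cutEdges G X) := by
  rw [Finset.disjoint_left]
  intro e
  induction e with
  | _ a b => rw [mk_mem_insideEdges, mk_mem_cutEdges]; tauto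

theorem cutEdges_compl (X : Finset V) : cutEdges G Xᶜ = cutEdges G X := by
  ext e
  induction e with
  | _ a b => simp only [mk_mem_cutEdges, Finset.mem_compl]; tauto

/-- Double counting of incidences between the vertices of `X` and a set of edges. -/
theorem sum_card_incident {D : Finset (Sym2 V)} (hD : D ⊆ edgesOf G) (X : Finset V) :
    ∑ v ∈ X, #{e ∈ D | v ∈ e} = 2 * #(D ∩ insideEdges G X) + #(D ∩ cutEdges G X) := by
  have key : ∀ e ∈ D, #{v ∈ X | v ∈ e} =
      2 * (if e ∈ insideEdges G X then 1 else 0) + if e ∈ cutEdges G X then 1 else 0 := by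
    intro e he
    have heG := hD he
    induction e with
    | _ a b =>
      rw [mk_mem_edgesOf] at heG
      have hab := heG.ne
      simp only [mk_mem_insideEdges, mk_mem_cutEdges, heG, true_and, Sym2.mem_iff]
      have : {v ∈ X | v = a ∨ v = b} = ({a, b} : Finset V).filter (· ∈ X) := by
        ext v; simp; tauto
      rw [this]
      by_cases ha : a ∈ X <;> by_cases hb : b ∈ X <;>
        simp [Finset.filter_insert, Finset.filter_singleton, ha, hb, hab]
  have h := Finset.sum_card_bipartiteAbove_eq_sum_card_bipartiteBelow
    (s := X) (t := D) (fun (v : V) (e : Sym2 V) => v ∈ e)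
  simp only [Finset.bipartiteAbove, Finset.bipartiteBelow] at h
  rw [h, Finset.sum_congr rfl key, Finset.sum_add_distrib, ← Finset.mul_sum]
  simp

/-- `G` is regular of degree three, in terms of incident edges. -/
theorem card_incident_eq_three (hc : ∀ v : V, (G.neighborSet v).ncard = 3) (v : V) :
    #{e ∈ edgesOf G | v ∈ e} = 3 := by
  rw [← hc v, ← Set.ncard_coe_finset]
  symm
  refine Set.ncard_congr (fun w _ => s(v, w)) ?_ ?_ ?_
  · intro w hw
    simpa [mk_mem_edgesOf] using hw
  · intro a b _ _ h
    exact Sym2.congr_right.1 h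
  · intro e he
    simp only [Finset.coe_filter, Set.mem_ofPred_eq] at he
    obtain ⟨w, rfl⟩ := he.2
    exact ⟨w, mk_mem_edgesOf.1 he.1, rfl⟩

theorem three_mul_card (hc : ∀ v : V, (G.neighborSet v).ncard = 3) (X : Finset V) :
    3 * #X = 2 * #(insideEdges G X) + #(cutEdges G X) := by
  have h := sum_card_incident (Finset.Subset.refl (edgesOf G)) X
  rw [Finset.inter_eq_right.2 (insideEdges_subset X),
    Finset.inter_eq_right.2 (cutEdges_subset X)] at h
  rw [← h, Finset.sum_congr rfl fun v _ => card_incident_eq_three hc v]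
  simp [mul_comm]

/-- In a cubic 3-connected graph every edge cut has at least three edges. -/
theorem three_le_card_cutEdges (hc : ∀ v : V, (G.neighborSet v).ncard = 3)
    (h3 : ∀ s : Set V, s.ncard ≤ 2 → (G.induce sᶜ).Connected) {X : Finset V}
    (hX : X.Nonempty) (hX' : Xᶜ.Nonempty) : 3 ≤ #(cutEdges G X) := by
  by_contra! hlt
  classical
  set s : Finset V := {a ∈ X | ∃ b ∉ X, G.Adj a b} with hs
  have hs_card : #s ≤ #(cutEdges G X) := by
    have h := sum_card_incident (cutEdges_subset (G := G) X) X
    rw [Finset.inter_self, Finset.inter_comm,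
      Finset.disjoint_iff_inter_eq_empty.1 (disjoint_insideEdges_cutEdges X)] at h
    have h' : ∑ v ∈ s, 1 ≤ ∑ v ∈ X, #{e ∈ cutEdges G X | v ∈ e} := by
      refine (Finset.sum_le_sum fun v hv => ?_).trans
        (Finset.sum_le_sum_of_subset (Finset.filter_subset _ _))
      obtain ⟨hvX, b, hb, hvb⟩ := Finset.mem_filter.1 hv
      exact Finset.card_pos.2 ⟨s(v, b), Finset.mem_filter.2
        ⟨mk_mem_cutEdges.2 ⟨hvb, Or.inl ⟨hvX, hb⟩⟩, Sym2.mem_mk_left _ _⟩⟩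
    simpa [h] using h'
  by_cases hsub : X ⊆ s
  · have hX2 : #X ≤ 2 := (Finset.card_le_card hsub).trans (by omega)
    have hins : #(insideEdges G X) ≤ (#X).choose 2 := by
      rw [← Sym2.card_image_offDiag]
      refine Finset.card_le_card fun e => ?_
      induction e with
      | _ a b =>
        rw [mk_mem_insideEdges]
        rintro ⟨hab, ha, hb⟩
        exact Finset.mem_image.2 ⟨(a, b), Finset.mem_offDiag.2 ⟨ha, hb, hab.ne⟩, rfl⟩
    have h := three_mul_card hc X
    have hpos := hX.card_pos
    interval_cases hn : #X <;> simp [-Finset.card_eq_zero] at hins <;> omega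
  · obtain ⟨x, hxX, hxs⟩ := Finset.not_subset.1 hsub
    obtain ⟨y, hy⟩ := hX'
    rw [Finset.mem_compl] at hy
    have hys : y ∉ s := fun h => hy (Finset.mem_filter.1 h).1
    have hcon := h3 (s : Set V) (by rw [Set.ncard_coe_finset]; omega)
    obtain ⟨p⟩ := hcon.preconnected ⟨x, by simpa using hxs⟩ ⟨y, by simpa using hys⟩
    obtain ⟨d, -, hd1, hd2⟩ := p.exists_boundary_dart {z | (z : V) ∈ X} hxX hy
    exact d.fst.2 (Finset.mem_coe.2 (Finset.mem_filter.2 ⟨hd1, d.snd, hd2, d.adj⟩))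

end Cuts

theorem finrank_le_one_of_forall_eq {K ι : Type*} [Field K] [Fintype ι]
    (N : Submodule K (ι → K)) (h : ∀ x ∈ N, ∀ i j, x i = x j) : Module.finrank K N ≤ 1 := by
  have hle : N ≤ Submodule.span K {fun _ => 1} := by
    intro x hx
    rw [Submodule.mem_span_singleton]
    rcases isEmpty_or_nonempty ι with _ | ⟨⟨i⟩⟩
    · exact ⟨0, Subsingleton.elim _ _⟩
    · exact ⟨x i, funext fun j => by simpa using h x hx i j⟩
  refine (Submodule.finrank_mono hle).trans ?_
  simpa using finrank_span_le_card (R := K) ({fun _ => 1} : Set (ι → K))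

namespace IsFullerene

variable {V : Type*} [Fintype V] [DecidableEq V] {G : SimpleGraph V}
  {faces : Finset (Finset (Sym2 V))}

theorem connected (hF : IsFullerene G faces) : G.Connected := by
  have h := hF.threeConnected ∅ (by simp)
  rw [Set.compl_empty] at h
  exact (SimpleGraph.induceUnivIso G).connected_iff.1 h

theorem face_subset (hF : IsFullerene G faces) {f : Finset (Sym2 V)} (hf : f ∈ faces) :
    f ⊆ edgesOf G := by
  obtain ⟨v, c, -, rfl⟩ := hF.face_cycle f hf
  intro e he
  exact mem_edgesOf.2 (c.edges_subset_edgeSet (List.mem_toFinset.1 he))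

theorem face_card_ge (hF : IsFullerene G faces) {f : Finset (Sym2 V)} (hf : f ∈ faces) :
    5 ≤ #f := by
  have := hF.face_size f hf
  omega

theorem face_card_le (hF : IsFullerene G faces) {f : Finset (Sym2 V)} (hf : f ∈ faces) :
    #f ≤ 6 := by
  have := hF.face_size f hf
  omega

/-- A face boundary uses exactly two edges at each of its vertices. -/
theorem card_incident_face (hF : IsFullerene G faces) {f : Finset (Sym2 V)} (hf : f ∈ faces)
    {e : Sym2 V} (he : e ∈ f)
    {v : V} (hv : v ∈ e) : #{e ∈ f | v ∈ e} = 2 := by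
  obtain ⟨u, c, hc, rfl⟩ := hF.face_cycle f hf
  obtain ⟨w, rfl⟩ := hv
  rw [List.mem_toFinset] at he
  rw [← hc.ncard_neighborSet_toSubgraph_eq_two (c.fst_mem_support_of_mem_edges he),
    ← Set.ncard_coe_finset]
  symm
  refine Set.ncard_congr (fun w _ => s(v, w)) ?_ ?_ ?_
  · intro w hw
    simpa [Walk.adj_toSubgraph_iff_mem_edges] using hw
  · intro a b _ _ h
    exact Sym2.congr_right.1 h
  · intro e he
    simp only [Finset.coe_filter, Set.mem_ofPred_eq, List.mem_toFinset] at he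
    obtain ⟨w, rfl⟩ := he.2
    exact ⟨w, Walk.adj_toSubgraph_iff_mem_edges.2 he.1, rfl⟩

theorem even_card_incident_face (hF : IsFullerene G faces) {f : Finset (Sym2 V)} (hf : f ∈ faces)
    (v : V) :
    Even #{e ∈ f | v ∈ e} := by
  rcases Finset.eq_empty_or_nonempty {e ∈ f | v ∈ e} with h | ⟨e, he⟩
  · simp [h]
  · obtain ⟨he, hv⟩ := Finset.mem_filter.1 he
    rw [hF.card_incident_face hf he hv]
    exact even_two

/-- A face boundary crosses every cut an even number of times. -/
theorem even_card_inter_cutEdges (hF : IsFullerene G faces) {f : Finset (Sym2 V)} (hf : f ∈ faces)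
    (X : Finset V) :
    Even #(f ∩ cutEdges G X) := by
  have h := sum_card_incident (hF.face_subset hf) X
  have h' : Even (∑ v ∈ X, #{e ∈ f | v ∈ e}) :=
    Finset.even_sum _ fun v _ => hF.even_card_incident_face hf v
  rw [h] at h'
  simpa [Nat.even_add] using h'

/-- A face boundary that does not cross `X` lies on one side of it. -/
theorem face_subset_insideEdges (hF : IsFullerene G faces) {f : Finset (Sym2 V)} (hf : f ∈ faces)
    {X : Finset V}
    (h0 : f ∩ cutEdges G X = ∅) (h1 : (f ∩ insideEdges G X).Nonempty) :
    f ⊆ insideEdges G X := by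
  have hsub := hF.face_subset hf
  obtain ⟨u, c, hc, rfl⟩ := hF.face_cycle f hf
  have hno : ∀ a b, s(a, b) ∈ c.edges → a ∈ X → b ∈ X := by
    intro a b hab ha
    by_contra hb
    have : s(a, b) ∈ c.edges.toFinset ∩ cutEdges G X :=
      Finset.mem_inter.2 ⟨List.mem_toFinset.2 hab,
        mk_mem_cutEdges.2 ⟨c.adj_of_mem_edges hab, Or.inl ⟨ha, hb⟩⟩⟩
    simp [h0] at this
  have hside : ∀ z ∈ c.support, (u ∈ X ↔ z ∈ X) := by
    intro z hz
    have hsub := c.edges_takeUntil_subset_edges hz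
    constructor
    · intro hu
      by_contra hzX
      obtain ⟨d, hd, hd1, hd2⟩ := (c.takeUntil z hz).exists_boundary_dart (X : Set V) hu hzX
      exact hd2 (hno _ _ (hsub (List.mem_map_of_mem hd)) hd1)
    · intro hzX
      by_contra hu
      obtain ⟨d, hd, hd1, hd2⟩ :=
        (c.takeUntil z hz).exists_boundary_dart ((X : Set V)ᶜ) hu (by simpa using hzX)
      refine hd1 (hno d.snd d.fst ?_ (by simpa using hd2))
      rw [Sym2.eq_swap]
      exact hsub (List.mem_map_of_mem hd)
  obtain ⟨e, he⟩ := h1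
  obtain ⟨hec, heX⟩ := Finset.mem_inter.1 he
  intro e' he'
  have hG := hsub he'
  induction e with
  | _ a b =>
    induction e' with
    | _ x y =>
      rw [List.mem_toFinset] at hec he'
      rw [mk_mem_insideEdges] at heX ⊢
      have ha := hside a (c.fst_mem_support_of_mem_edges hec)
      have hx := hside x (c.fst_mem_support_of_mem_edges he')
      have hy := hside y (c.snd_mem_support_of_mem_edges he')
      exact ⟨mk_mem_edgesOf.1 hG, by tauto, by tauto⟩

/-- Two faces with a common vertex share an edge at that vertex. -/
theorem exists_common_edge (hF : IsFullerene G faces) {f g : Finset (Sym2 V)} (hf : f ∈ faces)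
    (hg : g ∈ faces) {v : V}
    {e e' : Sym2 V} (he : e ∈ f) (hve : v ∈ e) (he' : e' ∈ g) (hve' : v ∈ e') :
    ∃ d, d ∈ f ∧ d ∈ g ∧ v ∈ d := by
  have hf2 := hF.card_incident_face hf he hve
  have hg2 := hF.card_incident_face hg he' hve'
  have hU : #({e ∈ f | v ∈ e} ∪ {e ∈ g | v ∈ e}) ≤ 3 := by
    rw [← card_incident_eq_three hF.cubic v]
    refine Finset.card_le_card (Finset.union_subset ?_ ?_)
    · exact Finset.filter_subset_filter _ (hF.face_subset hf)
    · exact Finset.filter_subset_filter _ (hF.face_subset hg)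
  have hI := Finset.card_union_add_card_inter {e ∈ f | v ∈ e} {e ∈ g | v ∈ e}
  obtain ⟨d, hd⟩ := Finset.card_pos.1
    (show 0 < #({e ∈ f | v ∈ e} ∩ {e ∈ g | v ∈ e}) by omega)
  simp only [Finset.mem_inter, Finset.mem_filter] at hd
  exact ⟨d, hd.1.1, hd.2.1, hd.1.2⟩

theorem card_faces_through (hF : IsFullerene G faces) {e : Sym2 V} (he : e ∈ edgesOf G) :
    #{f ∈ faces | e ∈ f} = 2 :=
  hF.edge_two_faces e (mem_edgesOf.1 he)

/-- The dual graph is connected: a labelling of the faces which agrees across every edge is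
constant. -/
theorem label_eq_of_agree (hF : IsFullerene G faces) {α : Type*} (x : Finset (Sym2 V) → α)
    (hx : ∀ f ∈ faces, ∀ g ∈ faces, ∀ e, e ∈ f → e ∈ g → x f = x g)
    {f g : Finset (Sym2 V)} (hf : f ∈ faces) (hg : g ∈ faces) : x f = x g := by
  have key : ∀ u v : V, G.Reachable u v → ∀ f ∈ faces, ∀ g ∈ faces, ∀ e ∈ f, ∀ e' ∈ g,
      u ∈ e → v ∈ e' → x f = x g := by
    rintro u v ⟨p⟩
    induction p with
    | nil =>
      intro f hf g hg e he e' he' hu hv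
      obtain ⟨d, hdf, hdg, -⟩ := hF.exists_common_edge hf hg he hu he' hv
      exact hx f hf g hg d hdf hdg
    | @cons u w v huw p ih =>
      intro f hf g hg e he e' he' hu hv
      have h2 := hF.card_faces_through (mk_mem_edgesOf.2 huw)
      obtain ⟨k, hk⟩ := Finset.card_pos.1 (h2 ▸ zero_lt_two)
      obtain ⟨hk, hek⟩ := Finset.mem_filter.1 hk
      obtain ⟨d, hdf, hdk, -⟩ :=
        hF.exists_common_edge hf hk he hu hek (Sym2.mem_mk_left _ _)
      exact (hx f hf k hk d hdf hdk).trans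
        (ih k hk g hg _ hek e' he' (Sym2.mem_mk_right _ _) hv)
  have hfc := hF.face_card_ge hf
  have hgc := hF.face_card_ge hg
  obtain ⟨e, he⟩ := Finset.card_pos.1 (show 0 < #f by omega)
  obtain ⟨e', he'⟩ := Finset.card_pos.1 (show 0 < #g by omega)
  induction e with
  | _ a b =>
    induction e' with
    | _ c d =>
      exact key a c (hF.connected.preconnected a c) f hf g hg _ he _ he'
        (Sym2.mem_mk_left _ _) (Sym2.mem_mk_left _ _)

/-- Planarity in homological form: a set of edges that meets every face boundary an even number
of times is a cut. -/
theorem exists_cutEdges_eq (hF : IsFullerene G faces) {D : Finset (Sym2 V)} (hD : D ⊆ edgesOf G)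
    (hDf : ∀ f ∈ faces, Even #(f ∩ D)) : ∃ X : Finset V, cutEdges G X = D := by
  classical
  let A : Matrix faces (edgesOf G) (ZMod 2) := Matrix.of fun f e => if e.1 ∈ f.1 then 1 else 0
  let B : Matrix (edgesOf G) V (ZMod 2) := Matrix.of fun e v => if v ∈ e.1 then 1 else 0
  have sum_edges : ∀ f ∈ faces, ∀ P : Sym2 V → Prop, ∀ _ : DecidablePred P,
      ∑ e : edgesOf G, (if e.1 ∈ f then (1 : ZMod 2) else 0) * (if P e.1 then 1 else 0) =
        (#{e ∈ f | P e} : ℕ) := by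
    intro f hf P _
    rw [Finset.sum_coe_sort (edgesOf G)
      (fun e => (if e ∈ f then (1 : ZMod 2) else 0) * (if P e then 1 else 0))]
    simp only [← ite_and, mul_ite, mul_one, mul_zero, Finset.sum_boole]
    congr 2
    ext e
    have hsub : e ∈ f → e ∈ edgesOf G := fun h => hF.face_subset hf h
    simp only [Finset.mem_filter]
    tauto
  have hAB : ∀ x, A.mulVec (B.mulVec x) = 0 := by
    intro x
    rw [Matrix.mulVec_mulVec]
    have : A * B = 0 := by
      ext f v
      rw [Matrix.mul_apply]
      simp only [A, B, Matrix.of_apply, Matrix.zero_apply]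
      rw [sum_edges f.1 f.2 (fun e => v ∈ e), ZMod.natCast_eq_zero_iff_even]
      exact hF.even_card_incident_face f.2 v
    rw [this, Matrix.zero_mulVec]
  have hmem : ∀ (x : V → ZMod 2) (a b : V) (h : s(a, b) ∈ edgesOf G),
      B.mulVec x ⟨s(a, b), h⟩ = x a + x b := by
    intro x a b h
    have hab := (mk_mem_edgesOf.1 h).ne
    simp only [B, Matrix.mulVec, dotProduct, Matrix.of_apply, Sym2.mem_iff, ite_mul, one_mul,
      zero_mul]
    rw [← Finset.sum_filter]
    have : ({v | v = a ∨ v = b} : Finset V) = {a, b} := by ext; simp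
    rw [this, Finset.sum_pair hab]
  have two : ∀ a b : ZMod 2, a + b = 0 → a = b := by decide
  have hkerB : Module.finrank (ZMod 2) (LinearMap.ker B.mulVecLin) ≤ 1 := by
    refine finrank_le_one_of_forall_eq _ fun x hx a b => ?_
    rw [LinearMap.mem_ker, Matrix.mulVecLin_apply] at hx
    obtain ⟨p⟩ := hF.connected.preconnected a b
    induction p with
    | nil => rfl
    | @cons a w b h p ih =>
      refine (two _ _ ?_).trans ih
      rw [← hmem x a w (mk_mem_edgesOf.2 h), hx]
      rfl
  have hkerA : Module.finrank (ZMod 2) (LinearMap.ker A.transpose.mulVecLin) ≤ 1 := by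
    refine finrank_le_one_of_forall_eq _ fun x hx f g => ?_
    rw [LinearMap.mem_ker, Matrix.mulVecLin_apply] at hx
    let y : Finset (Sym2 V) → ZMod 2 := fun f => if h : f ∈ faces then x ⟨f, h⟩ else 0
    have hy : ∀ f : faces, y f.1 = x f := fun f => by simp [y]
    rw [← hy f, ← hy g]
    refine hF.label_eq_of_agree y ?_ f.2 g.2
    intro f hf g hg e hef heg
    rcases eq_or_ne f g with rfl | hfg
    · rfl
    have heE := hF.face_subset hf hef
    have h0 := congrFun hx ⟨e, heE⟩
    simp only [A, Matrix.mulVec, dotProduct, Matrix.transpose_apply, Matrix.of_apply, ite_mul,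
      one_mul, zero_mul, ← hy, Pi.zero_apply] at h0
    rw [Finset.sum_coe_sort faces (fun f => if e ∈ f then y f else 0),
      ← Finset.sum_filter] at h0
    have hpair : ({f ∈ faces | e ∈ f}) = {f, g} := by
      symm
      refine Finset.eq_of_subset_of_card_le ?_ ?_
      · intro k hk
        rcases Finset.mem_insert.1 hk with rfl | hk
        · exact Finset.mem_filter.2 ⟨hf, hef⟩
        · rw [Finset.mem_singleton.1 hk]
          exact Finset.mem_filter.2 ⟨hg, heg⟩
      · rw [hF.card_faces_through heE, Finset.card_pair hfg]
    rw [hpair, Finset.sum_pair hfg] at h0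
    exact two _ _ h0
  have hle : LinearMap.range B.mulVecLin ≤ LinearMap.ker A.mulVecLin := by
    rintro _ ⟨x, rfl⟩
    exact hAB x
  have heq : LinearMap.range B.mulVecLin = LinearMap.ker A.mulVecLin := by
    refine Submodule.eq_of_le_of_finrank_le hle ?_
    have h1 := B.mulVecLin.finrank_range_add_finrank_ker
    have h2 := A.mulVecLin.finrank_range_add_finrank_ker
    have h3 := A.transpose.mulVecLin.finrank_range_add_finrank_ker
    have h4 : Module.finrank (ZMod 2) (LinearMap.range A.transpose.mulVecLin) =
        Module.finrank (ZMod 2) (LinearMap.range A.mulVecLin) := A.rank_transpose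
    have h5 := hF.euler
    have h6 : G.edgeSet.ncard = #(edgesOf G) := by
      rw [← Set.ncard_coe_finset]
      congr 1
      ext e
      simp [mem_edgesOf]
    simp only [Module.finrank_fintype_fun_eq_card, Fintype.card_coe] at h1 h2 h3
    omega
  have hy : (fun e : edgesOf G => if e.1 ∈ D then (1 : ZMod 2) else 0) ∈
      LinearMap.range B.mulVecLin := by
    rw [heq, LinearMap.mem_ker, Matrix.mulVecLin_apply]
    ext f
    simp only [A, Matrix.mulVec, dotProduct, Matrix.of_apply, Pi.zero_apply]
    rw [sum_edges f.1 f.2 (fun e => e ∈ D), ZMod.natCast_eq_zero_iff_even,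
      Finset.filter_mem_eq_inter]
    exact hDf f.1 f.2
  obtain ⟨x, hx⟩ := hy
  refine ⟨Finset.univ.filter fun v => x v = 1, ?_⟩
  ext e
  induction e with
  | _ a b =>
    by_cases he : s(a, b) ∈ edgesOf G
    · have h := congrFun hx ⟨s(a, b), he⟩
      rw [Matrix.mulVecLin_apply, hmem] at h
      rw [mk_mem_cutEdges]
      simp only [mk_mem_edgesOf.1 he, Finset.mem_filter, Finset.mem_univ, true_and]
      have h01 : ∀ a b : ZMod 2, (a + b = 1 ↔ (a = 1 ∧ ¬ b = 1 ∨ b = 1 ∧ ¬ a = 1)) := by decide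
      rw [← h01, h]
      simp
    · exact iff_of_false (fun h => he (cutEdges_subset _ h)) fun h => he (hD h)

/-- Two distinct faces share at most one edge. -/
theorem card_inter_faces_le_one (hF : IsFullerene G faces) {f g : Finset (Sym2 V)} (hf : f ∈ faces)
    (hg : g ∈ faces)
    (hfg : f ≠ g) : #(f ∩ g) ≤ 1 := by
  by_contra! hlt
  obtain ⟨d, hd, e, he, hde⟩ := Finset.one_lt_card.1 hlt
  rw [Finset.mem_inter] at hd he
  have hdE := hF.face_subset hf hd.1
  have heE := hF.face_subset hf he.1
  have two : ∀ e, e ∈ f → e ∈ g → ∀ k ∈ faces, e ∈ k → k = f ∨ k = g := by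
    intro e hef heg k hk hek
    by_contra! hne
    have hsub : {k, f, g} ⊆ ({k ∈ faces | e ∈ k}) := by
      simp [Finset.insert_subset_iff, *]
    have hcard := Finset.card_le_card hsub
    rw [hF.card_faces_through (hF.face_subset hf hef), Finset.card_eq_three.2
      ⟨k, f, g, hne.1, hne.2, hfg, rfl⟩] at hcard
    omega
  obtain ⟨X, hX⟩ := hF.exists_cutEdges_eq (D := {d, e})
    (by simp [Finset.insert_subset_iff, hdE, heE]) (by
      intro k hk
      by_cases hkk : k = f ∨ k = g
      · have : k ∩ {d, e} = {d, e} := by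
          rw [Finset.inter_eq_right]
          rcases hkk with rfl | rfl <;> simp [Finset.insert_subset_iff, *]
        rw [this, Finset.card_pair hde]
        exact even_two
      · have : k ∩ {d, e} = ∅ := by
          ext z
          simp only [Finset.mem_inter, Finset.mem_insert, Finset.mem_singleton,
            Finset.notMem_empty, iff_false]
          rintro ⟨hz, rfl | rfl⟩
          · exact hkk (two _ hd.1 hd.2 k hk hz)
          · exact hkk (two _ he.1 he.2 k hk hz)
        simp [this])
  have hdX : d ∈ cutEdges G X := by simp [hX]
  have hc : #(cutEdges G X) = 2 := by rw [hX, Finset.card_pair hde]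
  induction d with
  | _ a b =>
    rw [mk_mem_cutEdges] at hdX
    have h3 := three_le_card_cutEdges hF.cubic hF.threeConnected (X := X)
      (by rcases hdX.2 with h | h; exacts [⟨_, h.1⟩, ⟨_, h.1⟩])
      (by rcases hdX.2 with h | h <;> exact ⟨_, Finset.mem_compl.2 h.2⟩)
    omega

end IsFullerene

section ThreeCuts

variable {V : Type*} [Fintype V] [DecidableEq V] (G : SimpleGraph V)
  (faces : Finset (Finset (Sym2 V)))

/-- The faces whose boundary crosses the cut defined by `K`. -/
noncomputable def crossingFaces (K : Finset V) : Finset (Finset (Sym2 V)) :=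
  {f ∈ faces | (f ∩ cutEdges G K).Nonempty}

/-- The edges inside `K` lying on a face that crosses the cut defined by `K`. -/
noncomputable def ringEdges (K : Finset V) : Finset (Sym2 V) :=
  (crossingFaces G faces K).biUnion fun f => f ∩ insideEdges G K

/-- The vertices of `K` lying on a face that crosses the cut defined by `K`. -/
noncomputable def ringVerts (K : Finset V) : Finset V :=
  {v ∈ K | ∃ f ∈ crossingFaces G faces K, ∃ e ∈ f, v ∈ e}

variable {G faces}

theorem mem_crossingFaces {K : Finset V} {f : Finset (Sym2 V)} (hf : f ∈ faces) {e : Sym2 V}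
    (he : e ∈ f) (heK : e ∈ cutEdges G K) : f ∈ crossingFaces G faces K :=
  Finset.mem_filter.2 ⟨hf, e, Finset.mem_inter.2 ⟨he, heK⟩⟩

theorem crossingFaces_compl (K : Finset V) :
    crossingFaces G faces Kᶜ = crossingFaces G faces K := by
  rw [crossingFaces, cutEdges_compl, crossingFaces]

theorem mem_ringEdges {K : Finset V} {e : Sym2 V} : e ∈ ringEdges G faces K ↔
    e ∈ insideEdges G K ∧ ∃ f ∈ crossingFaces G faces K, e ∈ f := by
  simp only [ringEdges, Finset.mem_biUnion, Finset.mem_inter]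
  tauto

theorem mem_insideEdges_of_notMem_cutEdges {K : Finset V} {e : Sym2 V} {v : V}
    (he : e ∈ edgesOf G) (hv : v ∈ e) (hvK : v ∈ K) (hcut : e ∉ cutEdges G K) :
    e ∈ insideEdges G K := by
  obtain ⟨w, rfl⟩ := hv
  rw [mk_mem_edgesOf] at he
  rw [mk_mem_cutEdges] at hcut
  rw [mk_mem_insideEdges]
  tauto

namespace IsFullerene

variable {K : Finset V}

/-- Every edge is on two faces, so face sizes restricted to `D` add up to twice the size of
`D`. -/
theorem sum_card_inter_faces (hF : IsFullerene G faces) {D : Finset (Sym2 V)} (hD : D ⊆ edgesOf G) :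
    ∑ f ∈ faces, #(f ∩ D) = 2 * #D := by
  have h := Finset.sum_card_bipartiteAbove_eq_sum_card_bipartiteBelow
    (s := faces) (t := D) (fun (f : Finset (Sym2 V)) (e : Sym2 V) => e ∈ f)
  simp only [Finset.bipartiteAbove, Finset.bipartiteBelow] at h
  rw [Finset.sum_congr rfl fun e he => hF.card_faces_through (hD he)] at h
  simp only [Finset.filter_mem_eq_inter, Finset.inter_comm D] at h
  rw [h]
  simp [mul_comm]

theorem card_inter_cutEdges_eq_two (hF : IsFullerene G faces) (hK : #(cutEdges G K) = 3)
    {f : Finset (Sym2 V)}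
    (hf : f ∈ crossingFaces G faces K) : #(f ∩ cutEdges G K) = 2 := by
  obtain ⟨hf, hne⟩ := Finset.mem_filter.1 hf
  have hpos := hne.card_pos
  have hle : #(f ∩ cutEdges G K) ≤ 3 := hK ▸ Finset.card_le_card Finset.inter_subset_right
  obtain ⟨r, hr⟩ := hF.even_card_inter_cutEdges hf K
  omega

theorem card_crossingFaces (hF : IsFullerene G faces) (hK : #(cutEdges G K) = 3) :
    #(crossingFaces G faces K) = 3 := by
  have h := hF.sum_card_inter_faces (cutEdges_subset K)
  have h' : ∑ f ∈ crossingFaces G faces K, #(f ∩ cutEdges G K) =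
      ∑ f ∈ faces, #(f ∩ cutEdges G K) := by
    refine Finset.sum_subset (Finset.filter_subset _ _) fun f hf hf' => ?_
    rw [Finset.card_eq_zero, ← Finset.not_nonempty_iff_eq_empty]
    exact fun hne => hf' (Finset.mem_filter.2 ⟨hf, hne⟩)
  rw [Finset.sum_congr rfl fun f hf => hF.card_inter_cutEdges_eq_two hK hf,
    Finset.sum_const, smul_eq_mul] at h'
  omega

theorem eq_of_mem_insideEdges (hF : IsFullerene G faces) (hK : #(cutEdges G K) = 3)
    {f g : Finset (Sym2 V)}
    (hf : f ∈ crossingFaces G faces K) (hg : g ∈ crossingFaces G faces K) {e : Sym2 V}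
    (he : e ∈ insideEdges G K) (hef : e ∈ f) (heg : e ∈ g) : f = g := by
  by_contra hfg
  have h1 := hF.card_inter_faces_le_one (Finset.mem_filter.1 hf).1 (Finset.mem_filter.1 hg).1 hfg
  have hf2 := hF.card_inter_cutEdges_eq_two hK hf
  have hg2 := hF.card_inter_cutEdges_eq_two hK hg
  have hU : #(f ∩ cutEdges G K ∪ g ∩ cutEdges G K) ≤ 3 := by
    rw [← hK]
    exact Finset.card_le_card
      (Finset.union_subset Finset.inter_subset_right Finset.inter_subset_right)
  have hI := Finset.card_union_add_card_inter (f ∩ cutEdges G K) (g ∩ cutEdges G K)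
  obtain ⟨d, hd⟩ := Finset.card_pos.1
    (show 0 < #(f ∩ cutEdges G K ∩ (g ∩ cutEdges G K)) by omega)
  simp only [Finset.mem_inter] at hd
  have hde : d = e := Finset.card_le_one.1 h1 d (Finset.mem_inter.2 ⟨hd.1.1, hd.2.1⟩) e
    (Finset.mem_inter.2 ⟨hef, heg⟩)
  exact Finset.disjoint_left.1 (disjoint_insideEdges_cutEdges K) he (hde ▸ hd.1.2)

theorem card_ringEdges (hF : IsFullerene G faces) (hK : #(cutEdges G K) = 3) :
    #(ringEdges G faces K) = ∑ f ∈ crossingFaces G faces K, #(f ∩ insideEdges G K) := by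
  refine Finset.card_biUnion fun f hf g hg hfg => Finset.disjoint_left.2 fun e hef heg => hfg ?_
  rw [Finset.mem_inter] at hef heg
  exact hF.eq_of_mem_insideEdges hK hf hg hef.2 hef.1 heg.1

theorem card_ringEdges_add_compl_le (hF : IsFullerene G faces) (hK : #(cutEdges G K) = 3) :
    #(ringEdges G faces K) + #(ringEdges G faces Kᶜ) ≤ 12 := by
  have hK' : #(cutEdges G Kᶜ) = 3 := by rw [cutEdges_compl, hK]
  rw [hF.card_ringEdges hK, hF.card_ringEdges hK', crossingFaces_compl, ← Finset.sum_add_distrib]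
  have key : ∀ f ∈ crossingFaces G faces K,
      #(f ∩ insideEdges G K) + #(f ∩ insideEdges G Kᶜ) ≤ 4 := by
    intro f hf
    have h2 := hF.card_inter_cutEdges_eq_two hK hf
    have h6 := hF.face_card_le (Finset.mem_filter.1 hf).1
    have hdis : Disjoint (insideEdges G K) (insideEdges G Kᶜ) := by
      rw [Finset.disjoint_left]
      intro e
      induction e with
      | _ a b => simp only [mk_mem_insideEdges, Finset.mem_compl]; tauto
    have hdis' := (disjoint_insideEdges_cutEdges (G := G) K)
    have hdis'' := cutEdges_compl (G := G) K ▸ disjoint_insideEdges_cutEdges (G := G) Kᶜ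
    have hsub : (f ∩ insideEdges G K) ∪ (f ∩ insideEdges G Kᶜ) ∪ (f ∩ cutEdges G K) ⊆ f :=
      Finset.union_subset (Finset.union_subset Finset.inter_subset_left Finset.inter_subset_left)
        Finset.inter_subset_left
    have hcard := Finset.card_le_card hsub
    rw [Finset.card_union_of_disjoint, Finset.card_union_of_disjoint] at hcard
    · omega
    · exact hdis.mono Finset.inter_subset_right Finset.inter_subset_right
    · rw [Finset.disjoint_union_left]
      exact ⟨hdis'.mono Finset.inter_subset_right Finset.inter_subset_right,
        hdis''.mono Finset.inter_subset_right Finset.inter_subset_right⟩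
  refine (Finset.sum_le_sum key).trans ?_
  rw [Finset.sum_const, hF.card_crossingFaces hK]
  rfl

/-- The edges of a nontrivial 3-edge-cut form a matching. -/
theorem card_incident_cutEdges_le_one (hF : IsFullerene G faces) (hK : #(cutEdges G K) = 3)
    (h2 : 2 ≤ #K) {v : V}
    (hv : v ∈ K) : #{e ∈ cutEdges G K | v ∈ e} ≤ 1 := by
  by_contra! hlt
  have hne : (K.erase v).Nonempty := by
    rw [← Finset.card_pos, Finset.card_erase_of_mem hv]
    omega
  have h3 := three_le_card_cutEdges hF.cubic hF.threeConnected hne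
    ⟨v, by simp⟩
  have hsub : cutEdges G (K.erase v) ⊆ {e ∈ cutEdges G K | v ∉ e} ∪
      ({e ∈ edgesOf G | v ∈ e} \ {e ∈ cutEdges G K | v ∈ e}) := by
    intro e
    induction e with
    | _ a b =>
      simp only [Finset.mem_union, Finset.mem_sdiff, Finset.mem_filter, mk_mem_cutEdges,
        mk_mem_edgesOf, Finset.mem_erase, Sym2.mem_iff]
      grind
  have hcard := (Finset.card_le_card hsub).trans (Finset.card_union_le _ _)
  rw [Finset.card_sdiff_of_subset (Finset.filter_subset_filter _ (cutEdges_subset K)),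
    card_incident_eq_three hF.cubic] at hcard
  have hsplit := Finset.card_filter_add_card_filter_not (s := cutEdges G K) (fun e => v ∈ e)
  omega

/-- Every vertex of the ring is on at least two ring edges. -/
theorem two_le_card_incident_ringEdges (hF : IsFullerene G faces) (hK : #(cutEdges G K) = 3)
    (h2 : 2 ≤ #K) {v : V}
    (hv : v ∈ ringVerts G faces K) : 2 ≤ #{e ∈ ringEdges G faces K | v ∈ e} := by
  obtain ⟨hvK, f, hf, e, hef, hve⟩ := Finset.mem_filter.1 hv
  have hcut1 := hF.card_incident_cutEdges_le_one hK h2 hvK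
  by_cases hex : ∃ d ∈ cutEdges G K, v ∈ d
  · obtain ⟨d, hd, hvd⟩ := hex
    obtain ⟨f, g, hfg, hpair⟩ :=
      Finset.card_eq_two.1 (hF.card_faces_through (cutEdges_subset K hd))
    have hf : f ∈ faces ∧ d ∈ f := Finset.mem_filter.1 (hpair ▸ Finset.mem_insert_self f {g})
    have hg : g ∈ faces ∧ d ∈ g := Finset.mem_filter.1
      (hpair ▸ Finset.mem_insert_of_mem (Finset.mem_singleton_self g))
    have other : ∀ k ∈ faces, d ∈ k → ∃ e ∈ k, e ≠ d ∧ v ∈ e ∧ e ∈ ringEdges G faces K := by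
      intro k hk hdk
      have h2 := hF.card_incident_face hk hdk hvd
      obtain ⟨e, he, hed⟩ := Finset.exists_mem_ne (by omega : 1 < #{e ∈ k | v ∈ e}) d
      obtain ⟨hek, hve⟩ := Finset.mem_filter.1 he
      refine ⟨e, hek, hed, hve, mem_ringEdges.2 ⟨?_, k, mem_crossingFaces hk hdk hd, hek⟩⟩
      refine mem_insideEdges_of_notMem_cutEdges (hF.face_subset hk hek) hve hvK fun hecut => ?_
      exact hed (Finset.card_le_one.1 hcut1 e (Finset.mem_filter.2 ⟨hecut, hve⟩) d
        (Finset.mem_filter.2 ⟨hd, hvd⟩))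
    obtain ⟨e₁, he₁f, he₁d, hve₁, he₁⟩ := other f hf.1 hf.2
    obtain ⟨e₂, he₂g, he₂d, hve₂, he₂⟩ := other g hg.1 hg.2
    refine Finset.one_lt_card.2 ⟨e₁, Finset.mem_filter.2 ⟨he₁, hve₁⟩, e₂,
      Finset.mem_filter.2 ⟨he₂, hve₂⟩, ?_⟩
    rintro rfl
    exact he₁d (Finset.card_le_one.1 (hF.card_inter_faces_le_one hf.1 hg.1 hfg) e₁
      (Finset.mem_inter.2 ⟨he₁f, he₂g⟩) d (Finset.mem_inter.2 ⟨hf.2, hg.2⟩))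
  · have hfF := (Finset.mem_filter.1 hf).1
    rw [← hF.card_incident_face hfF hef hve]
    refine Finset.card_le_card fun d hd => ?_
    obtain ⟨hdf, hvd⟩ := Finset.mem_filter.1 hd
    refine Finset.mem_filter.2 ⟨mem_ringEdges.2 ⟨?_, f, hf, hdf⟩, hvd⟩
    exact mem_insideEdges_of_notMem_cutEdges (hF.face_subset hfF hdf) hvd hvK
      fun h => hex ⟨d, h, hvd⟩

theorem ringEdges_subset_insideEdges :
    ringEdges G faces K ⊆ insideEdges G (ringVerts G faces K) := by
  intro e he
  obtain ⟨heK, f, hf, hef⟩ := mem_ringEdges.1 he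
  induction e with
  | _ a b =>
    rw [mk_mem_insideEdges] at heK ⊢
    exact ⟨heK.1, Finset.mem_filter.2 ⟨heK.2.1, f, hf, _, hef, Sym2.mem_mk_left _ _⟩,
      Finset.mem_filter.2 ⟨heK.2.2, f, hf, _, hef, Sym2.mem_mk_right _ _⟩⟩

theorem mem_ringVerts_of_mem_cutEdges (hF : IsFullerene G faces) {a b : V} (ha : a ∈ K)
    (hb : b ∉ K) (hab : G.Adj a b) :
    a ∈ ringVerts G faces K := by
  have hcut : s(a, b) ∈ cutEdges G K := mk_mem_cutEdges.2 ⟨hab, Or.inl ⟨ha, hb⟩⟩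
  obtain ⟨f, hf⟩ := Finset.card_pos.1
    (hF.card_faces_through (cutEdges_subset K hcut) ▸ zero_lt_two)
  obtain ⟨hf, hef⟩ := Finset.mem_filter.1 hf
  exact Finset.mem_filter.2 ⟨ha, f, mem_crossingFaces hf hef hcut, _, hef, Sym2.mem_mk_left _ _⟩

theorem card_ringVerts_le (hF : IsFullerene G faces) (hK : #(cutEdges G K) = 3) (h2 : 2 ≤ #K) :
    #(ringVerts G faces K) ≤ #(ringEdges G faces K) := by
  have hsub := ringEdges_subset_insideEdges (G := G) (faces := faces) (K := K)
  have h := sum_card_incident (hsub.trans (insideEdges_subset _)) (ringVerts G faces K)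
  rw [Finset.inter_eq_left.2 hsub, Finset.disjoint_iff_inter_eq_empty.1
    ((disjoint_insideEdges_cutEdges _).mono_left hsub)] at h
  have hle := Finset.sum_le_sum fun v hv => hF.two_le_card_incident_ringEdges hK h2 (v := v) hv
  rw [h, Finset.sum_const, smul_eq_mul, Finset.card_empty] at hle
  omega

/-- Peeling off the ring leaves a cut that is smaller than the ring by at least three. -/
theorem card_cutEdges_sdiff_ringVerts (hF : IsFullerene G faces) (hK : #(cutEdges G K) = 3)
    (h2 : 2 ≤ #K) :
    #(cutEdges G (K \ ringVerts G faces K)) + 3 ≤ #(ringEdges G faces K) := by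
  have hle := hF.card_ringVerts_le hK h2
  have h3 := three_mul_card hF.cubic (ringVerts G faces K)
  have hin := Finset.card_le_card (ringEdges_subset_insideEdges (G := G) (faces := faces) (K := K))
  have hsub : cutEdges G K ∪ cutEdges G (K \ ringVerts G faces K) ⊆
      cutEdges G (ringVerts G faces K) := by
    intro e
    induction e with
    | _ a b =>
      have hr : ∀ x, x ∈ ringVerts G faces K → x ∈ K := fun x hx => (Finset.mem_filter.1 hx).1
      have hab := hF.mem_ringVerts_of_mem_cutEdges (K := K) (a := a) (b := b)
      have hba := hF.mem_ringVerts_of_mem_cutEdges (K := K) (a := b) (b := a)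
      have hsymm := G.adj_comm a b
      have := hr a
      have := hr b
      simp only [Finset.mem_union, mk_mem_cutEdges, Finset.mem_sdiff]
      grind
  have hdis : Disjoint (cutEdges G K) (cutEdges G (K \ ringVerts G faces K)) := by
    rw [Finset.disjoint_left]
    intro e
    induction e with
    | _ a b =>
      have hab := hF.mem_ringVerts_of_mem_cutEdges (K := K) (a := a) (b := b)
      have hba := hF.mem_ringVerts_of_mem_cutEdges (K := K) (a := b) (b := a)
      have hsymm := G.adj_comm a b
      simp only [mk_mem_cutEdges, Finset.mem_sdiff]
      grind
  have hcard := Finset.card_le_card hsub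
  rw [Finset.card_union_of_disjoint hdis] at hcard
  omega

/-- At least three faces lie strictly inside a nontrivial 3-edge-cut. -/
theorem card_ringEdges_add_le (hF : IsFullerene G faces) (hK : #(cutEdges G K) = 3) (h2 : 2 ≤ #K) :
    #(ringEdges G faces K) + 15 ≤ 2 * #(insideEdges G K) := by
  set I : Finset (Finset (Sym2 V)) :=
    {f ∈ faces \ crossingFaces G faces K | (f ∩ insideEdges G K).Nonempty} with hI
  have hIsub : ∀ f ∈ I, f ∈ faces ∧ f ⊆ insideEdges G K := by
    intro f hf
    obtain ⟨hf, hne⟩ := Finset.mem_filter.1 hf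
    obtain ⟨hf, hnc⟩ := Finset.mem_sdiff.1 hf
    refine ⟨hf, hF.face_subset_insideEdges hf ?_ hne⟩
    rw [← Finset.not_nonempty_iff_eq_empty]
    exact fun h => hnc (Finset.mem_filter.2 ⟨hf, h⟩)
  have hmem : ∀ f ∈ faces, ∀ e ∈ insideEdges G K, e ∈ f →
      f ∈ crossingFaces G faces K ∪ I := by
    intro f hf e he hef
    by_cases hc : f ∈ crossingFaces G faces K
    · exact Finset.mem_union_left _ hc
    · exact Finset.mem_union_right _ (Finset.mem_filter.2
        ⟨Finset.mem_sdiff.2 ⟨hf, hc⟩, e, Finset.mem_inter.2 ⟨hef, he⟩⟩)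
  have hdis : Disjoint (crossingFaces G faces K) I :=
    Finset.disjoint_left.2 fun f hf hfI =>
      (Finset.mem_sdiff.1 (Finset.mem_filter.1 hfI).1).2 hf
  have hcross : crossingFaces G faces K ⊆ faces := Finset.filter_subset _ _
  have hne : I.Nonempty := by
    obtain ⟨e, he⟩ : (ringEdges G faces K).Nonempty := by
      have := hF.card_cutEdges_sdiff_ringVerts hK h2
      exact Finset.card_pos.1 (by omega)
    obtain ⟨heK, f, hf, hef⟩ := mem_ringEdges.1 he
    have h2 := hF.card_faces_through (insideEdges_subset K heK)
    obtain ⟨g, hg, hgf⟩ := Finset.exists_mem_ne (by omega : 1 < #{f ∈ faces | e ∈ f}) f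
    obtain ⟨hg, heg⟩ := Finset.mem_filter.1 hg
    refine ⟨g, (Finset.mem_union.1 (hmem g hg e heK heg)).resolve_left fun hgc => hgf ?_⟩
    exact hF.eq_of_mem_insideEdges hK hgc hf heK heg hef
  have hI3 : 3 ≤ #I := by
    obtain ⟨f, hf⟩ := hne
    have hfF := (hIsub f hf).1
    have h5 := hF.face_card_ge hfF
    have hsub : f ⊆ ((crossingFaces G faces K ∪ I).erase f).biUnion fun g => f ∩ g := by
      intro e he
      have heK := (hIsub f hf).2 he
      have h2 := hF.card_faces_through (insideEdges_subset K heK)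
      obtain ⟨g, hg, hgf⟩ := Finset.exists_mem_ne (by omega : 1 < #{f ∈ faces | e ∈ f}) f
      obtain ⟨hg, heg⟩ := Finset.mem_filter.1 hg
      exact Finset.mem_biUnion.2 ⟨g, Finset.mem_erase.2 ⟨hgf, hmem g hg e heK heg⟩,
        Finset.mem_inter.2 ⟨he, heg⟩⟩
    have hle : #f ≤ #((crossingFaces G faces K ∪ I).erase f) * 1 := by
      refine (Finset.card_le_card hsub).trans (Finset.card_biUnion_le_card_mul _ _ _ ?_)
      intro g hg
      obtain ⟨hgf, hg⟩ := Finset.mem_erase.1 hg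
      refine hF.card_inter_faces_le_one hfF ?_ hgf.symm
      rcases Finset.mem_union.1 hg with hg | hg
      exacts [hcross hg, (hIsub g hg).1]
    rw [Finset.card_erase_of_mem (Finset.mem_union_right _ hf),
      Finset.card_union_of_disjoint hdis, hF.card_crossingFaces hK] at hle
    omega
  rw [← hF.sum_card_inter_faces (insideEdges_subset K), hF.card_ringEdges hK]
  have hsum : ∑ f ∈ crossingFaces G faces K ∪ I, #(f ∩ insideEdges G K) ≤
      ∑ f ∈ faces, #(f ∩ insideEdges G K) :=
    Finset.sum_le_sum_of_subset (Finset.union_subset hcross fun f hf => (hIsub f hf).1)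
  rw [Finset.sum_union hdis] at hsum
  have hI5 : ∑ f ∈ I, 5 ≤ ∑ f ∈ I, #(f ∩ insideEdges G K) := by
    refine Finset.sum_le_sum fun f hf => ?_
    rw [Finset.inter_eq_left.2 (hIsub f hf).2]
    exact hF.face_card_ge (hIsub f hf).1
  rw [Finset.sum_const, smul_eq_mul] at hI5
  omega

/-- A nontrivial 3-edge-cut with a short ring encloses a smaller one. -/
theorem exists_smaller_cut (hF : IsFullerene G faces) (hK : #(cutEdges G K) = 3) (h2 : 2 ≤ #K)
    (hring : #(ringEdges G faces K) ≤ 6) :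
    #(ringEdges G faces K) = 6 ∧ ∃ Y : Finset V, #Y < #K ∧ 2 ≤ #Y ∧ #(cutEdges G Y) = 3 ∧
      Y ⊆ K := by
  have h1 := hF.card_ringVerts_le hK h2
  have h3 := hF.card_cutEdges_sdiff_ringVerts hK h2
  have h4 := hF.card_ringEdges_add_le hK h2
  have h5 := three_mul_card hF.cubic K
  have hsub : ringVerts G faces K ⊆ K := Finset.filter_subset _ _
  have h6 := Finset.card_sdiff_add_card_eq_card hsub
  have hY2 : 2 ≤ #(K \ ringVerts G faces K) := by omega
  have hpos : 0 < #(ringVerts G faces K) := by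
    obtain ⟨e, he⟩ := Finset.card_pos.1 (hK ▸ three_pos)
    rw [Finset.card_pos]
    obtain ⟨heG, a, ha, b, hb, rfl⟩ := Finset.mem_filter.1 he
    exact ⟨a, hF.mem_ringVerts_of_mem_cutEdges ha hb (mk_mem_edgesOf.1 heG)⟩
  obtain ⟨v, hv⟩ := Finset.card_pos.1 hpos
  have hY3 := three_le_card_cutEdges hF.cubic hF.threeConnected
    (X := K \ ringVerts G faces K) (Finset.card_pos.1 (by omega)) ⟨v, by simp [hv]⟩
  exact ⟨by omega, K \ ringVerts G faces K, by omega, hY2, by omega, Finset.sdiff_subset⟩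

/-- Every 3-edge-cut isolates a single vertex. -/
theorem card_le_one_of_card_cutEdges (hF : IsFullerene G faces) (hK : #(cutEdges G K) = 3)
    (hK' : 2 ≤ #Kᶜ) : #K ≤ 1 := by
  induction hn : #K using Nat.strong_induction_on generalizing K with
  | _ n ih =>
    by_contra! hlt
    have hring : #(ringEdges G faces K) ≤ 6 := by
      by_contra! hlt'
      have hle := hF.card_ringEdges_add_compl_le hK
      have := (hF.exists_smaller_cut (K := Kᶜ) (by rw [cutEdges_compl, hK]) hK' (by omega)).1
      omega
    obtain ⟨-, Y, hYK, hY2, hY, hsub⟩ := hF.exists_smaller_cut hK (by omega) hring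
    have := ih #Y (by omega) hY
      (hK'.trans (Finset.card_le_card (Finset.compl_subset_compl.2 hsub))) rfl
    omega

end IsFullerene

end ThreeCuts

/-- A consequence of Tutte's theorem: in a graph of even order without perfect matching, removing
some set `S` leaves at least `|S| + 2` components. -/
theorem exists_components_of_not_hasPM {W : Type*} [Fintype W] [DecidableEq W]
    (G : SimpleGraph W) (heven : Even (Fintype.card W)) (hno : ¬ HasPM G) :
    ∃ (S : Finset W) (𝒞 : Finset (Finset W)), #S + 2 ≤ #𝒞 ∧
      (∀ C ∈ 𝒞, C.Nonempty ∧ Disjoint C S) ∧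
      (∀ C ∈ 𝒞, ∀ D ∈ 𝒞, C ≠ D → Disjoint C D) ∧
      ∀ C ∈ 𝒞, ∀ a ∈ C, ∀ b, G.Adj a b → b ∈ C ∨ b ∈ S := by
  classical
  rw [HasPM, SimpleGraph.tutte] at hno
  push Not at hno
  obtain ⟨u, hu⟩ := hno
  rw [SimpleGraph.IsTutteViolator] at hu
  set T := ((⊤ : G.Subgraph).deleteVerts u).coe with hT
  have hverts : ∀ w, w ∈ ((⊤ : G.Subgraph).deleteVerts u).verts ↔ w ∉ u := by simp
  have hparity := SimpleGraph.odd_ncard_oddComponents T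
  have hcard : Nat.card ((⊤ : G.Subgraph).deleteVerts u).verts + u.ncard = Fintype.card W := by
    rw [Nat.card_coe_set_eq, ← Nat.card_eq_fintype_card, ← Set.ncard_add_ncard_compl u, add_comm]
    congr 2
    ext w
    simp
  let F : T.ConnectedComponent → Finset W := fun c =>
    Finset.univ.filter fun w => ∃ h, T.connectedComponentMk ⟨w, h⟩ = c
  have hF : ∀ c w, w ∈ F c ↔ ∃ h, T.connectedComponentMk ⟨w, h⟩ = c := by simp [F]
  have hne : ∀ c, (F c).Nonempty := by
    intro c
    obtain ⟨⟨w, hw⟩, rfl⟩ := c.exists_rep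
    exact ⟨w, (hF _ _).2 ⟨hw, rfl⟩⟩
  have hdis : ∀ c d w, w ∈ F c → w ∈ F d → c = d := by
    intro c d w hc hd
    obtain ⟨h, rfl⟩ := (hF _ _).1 hc
    obtain ⟨_, rfl⟩ := (hF _ _).1 hd
    rfl
  refine ⟨u.toFinset, T.oddComponents.toFinite.toFinset.image F, ?_, ?_, ?_, ?_⟩
  · rw [Finset.card_image_of_injective, ← Set.ncard_eq_toFinset_card, ← Set.ncard_eq_toFinset_card']
    · rw [← Nat.not_even_iff_odd, ← Nat.not_even_iff_odd, not_iff_not] at hparity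
      have hpar : Even (T.oddComponents.ncard + u.ncard) := by
        rw [Nat.even_add, hparity, ← Nat.even_add, hcard]
        exact heven
      obtain ⟨r, hr⟩ := hpar
      omega
    · intro c d hcd
      obtain ⟨w, hw⟩ := hne c
      exact hdis c d w hw (hcd ▸ hw)
  · intro C hC
    obtain ⟨c, -, rfl⟩ := Finset.mem_image.1 hC
    refine ⟨hne c, Finset.disjoint_left.2 fun w hw hwu => ?_⟩
    obtain ⟨h, -⟩ := (hF _ _).1 hw
    exact (hverts w).1 h (Set.mem_toFinset.1 hwu)
  · intro C hC D hD hCD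
    obtain ⟨c, -, rfl⟩ := Finset.mem_image.1 hC
    obtain ⟨d, -, rfl⟩ := Finset.mem_image.1 hD
    exact Finset.disjoint_left.2 fun w hc hd => hCD (congrArg F (hdis c d w hc hd))
  · intro C hC a ha b hab
    obtain ⟨c, -, rfl⟩ := Finset.mem_image.1 hC
    obtain ⟨h, rfl⟩ := (hF _ _).1 ha
    by_cases hb : b ∈ u
    · exact Or.inr (Set.mem_toFinset.2 hb)
    · left
      have hau := (hverts a).1 h
      refine (hF _ _).2 ⟨(hverts b).2 hb, ?_⟩
      refine SimpleGraph.ConnectedComponent.sound (SimpleGraph.Adj.reachable ?_)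
      simp [hT, hau, hb, hab.symm]

/-- The vertices of a face boundary, as a finset. -/
def vertsOf {V : Type*} [Fintype V] [DecidableEq V] (f : Finset (Sym2 V)) : Finset V :=
  {v | ∃ e ∈ f, v ∈ e}

theorem mem_vertsOf {V : Type*} [Fintype V] [DecidableEq V] {f : Finset (Sym2 V)} {v : V} :
    v ∈ vertsOf f ↔ ∃ e ∈ f, v ∈ e := by
  simp [vertsOf]

namespace IsFullerene

variable {V : Type*} [Fintype V] [DecidableEq V] {G : SimpleGraph V}
  {faces : Finset (Finset (Sym2 V))}

theorem subset_insideEdges_vertsOf (hF : IsFullerene G faces) {h : Finset (Sym2 V)}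
    (hh : h ∈ faces) : h ⊆ insideEdges G (vertsOf h) := fun e he =>
  Finset.mem_filter.2 ⟨hF.face_subset hh he, fun _ hv => mem_vertsOf.2 ⟨e, he, hv⟩⟩

theorem card_vertsOf (hF : IsFullerene G faces) {h : Finset (Sym2 V)} (hh : h ∈ faces) :
    #(vertsOf h) = #h := by
  have hsub := hF.subset_insideEdges_vertsOf hh
  have hsum := sum_card_incident (hF.face_subset hh) (vertsOf h)
  rw [Finset.inter_eq_left.2 hsub, Finset.disjoint_iff_inter_eq_empty.1
    ((disjoint_insideEdges_cutEdges _).mono_left hsub)] at hsum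
  have htwo : ∀ v ∈ vertsOf h, #{e ∈ h | v ∈ e} = 2 := by
    intro v hv
    obtain ⟨e, he, hve⟩ := mem_vertsOf.1 hv
    exact hF.card_incident_face hh he hve
  rw [Finset.sum_congr rfl htwo, Finset.sum_const, smul_eq_mul, Finset.card_empty] at hsum
  omega

/-- Some pentagon avoids a given hexagon. -/
theorem exists_pentagon_disjoint (hF : IsFullerene G faces) {h : Finset (Sym2 V)} (hh : h ∈ faces)
    (hhex : #h = 6) :
    ∃ p ∈ faces, #p = 5 ∧ ∀ e ∈ p, ∀ v ∈ e, v ∉ vertsOf h := by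
  by_contra! hcon
  have hsub : {f ∈ faces | #f = 5} ⊆ h.biUnion fun e => ({f ∈ faces | e ∈ f}).erase h := by
    intro p hp
    obtain ⟨hp, hp5⟩ := Finset.mem_filter.1 hp
    obtain ⟨e, he, v, hve, hv⟩ := hcon p hp hp5
    obtain ⟨e', he', hve'⟩ := mem_vertsOf.1 hv
    obtain ⟨d, hdp, hdh, -⟩ := hF.exists_common_edge hp hh he hve he' hve'
    refine Finset.mem_biUnion.2 ⟨d, hdh, Finset.mem_erase.2 ⟨?_, Finset.mem_filter.2 ⟨hp, hdp⟩⟩⟩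
    rintro rfl
    omega
  have hcard := (Finset.card_le_card hsub).trans
    (Finset.card_biUnion_le_card_mul _ _ 1 fun e he => by
      rw [Finset.card_erase_of_mem (Finset.mem_filter.2 ⟨hh, he⟩),
        hF.card_faces_through (hF.face_subset hh he)])
  rw [hF.pentagons] at hcard
  omega

/-- No set `S` certifies that the fullerene minus a hexagon has no perfect matching. -/
theorem card_components_lt (hF : IsFullerene G faces) {h : Finset (Sym2 V)} (hh : h ∈ faces)
    (hhex : #h = 6) {S : Finset V} {𝒞 : Finset (Finset V)}
    (hS : Disjoint S (vertsOf h))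
    (hne : ∀ C ∈ 𝒞, C.Nonempty ∧ Disjoint C (S ∪ vertsOf h))
    (hdis : ∀ C ∈ 𝒞, ∀ D ∈ 𝒞, C ≠ D → Disjoint C D)
    (hclosed : ∀ C ∈ 𝒞, ∀ a ∈ C, ∀ b, G.Adj a b → b ∈ C ∨ b ∈ S ∪ vertsOf h) :
    #𝒞 < #S + 2 := by
  by_contra! hcard
  have hH6 : #(vertsOf h) = 6 := (hF.card_vertsOf hh).trans hhex
  set T := S ∪ vertsOf h with hT
  have hHT : vertsOf h ⊆ T := Finset.subset_union_right
  have hT6 : #T = #S + 6 := by rw [hT, Finset.card_union_of_disjoint hS, hH6]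
  have hcount := three_mul_card hF.cubic T
  have hhT : h ⊆ insideEdges G T := by
    intro e he
    have := hF.subset_insideEdges_vertsOf hh he
    induction e with
    | _ a b =>
      rw [mk_mem_insideEdges] at this ⊢
      exact ⟨this.1, hHT this.2.1, hHT this.2.2⟩
  have hins := Finset.card_le_card hhT
  have hCT : ∀ C ∈ 𝒞, ∀ v ∈ C, v ∉ T := fun C hC v hv => Finset.disjoint_left.1 (hne C hC).2 hv
  have hcutC : ∀ C ∈ 𝒞, ∀ e ∈ cutEdges G C, ∃ a ∈ C, ∃ b ∈ T, e = s(a, b) := by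
    intro C hC e he
    obtain ⟨heG, a, ha, b, hb, rfl⟩ := Finset.mem_filter.1 he
    exact ⟨a, ha, b, (hclosed C hC a ha b (mk_mem_edgesOf.1 heG)).resolve_left hb, rfl⟩
  have hUsub : 𝒞.biUnion (cutEdges G) ⊆ cutEdges G T := by
    intro e he
    obtain ⟨C, hC, he⟩ := Finset.mem_biUnion.1 he
    have heG := cutEdges_subset C he
    obtain ⟨a, ha, b, hb, rfl⟩ := hcutC C hC e he
    exact mk_mem_cutEdges.2 ⟨mk_mem_edgesOf.1 heG, Or.inr ⟨hb, hCT C hC a ha⟩⟩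
  have hUcard : #(𝒞.biUnion (cutEdges G)) = ∑ C ∈ 𝒞, #(cutEdges G C) := by
    refine Finset.card_biUnion fun C hC D hD hCD => Finset.disjoint_left.2 fun e heC heD => ?_
    obtain ⟨a, ha, b, hb, rfl⟩ := hcutC C hC e heC
    obtain ⟨a', ha', b', hb', hab⟩ := hcutC D hD _ heD
    rcases Sym2.eq_iff.1 hab with ⟨rfl, rfl⟩ | ⟨rfl, rfl⟩
    · exact Finset.disjoint_left.1 (hdis C hC D hD hCD) ha ha'
    · exact hCT C hC _ ha hb'
  have hHC : ∀ C ∈ 𝒞, vertsOf h ⊆ Cᶜ := fun C hC v hv =>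
    Finset.mem_compl.2 fun hvC => hCT C hC v hvC (hHT hv)
  have hge : ∀ C ∈ 𝒞, 3 ≤ #(cutEdges G C) := fun C hC =>
    three_le_card_cutEdges hF.cubic hF.threeConnected (hne C hC).1
      ((Finset.card_pos.1 (by omega)).mono (hHC C hC))
  have hsum : ∑ _C ∈ 𝒞, 3 ≤ ∑ C ∈ 𝒞, #(cutEdges G C) := Finset.sum_le_sum hge
  have hUle := Finset.card_le_card hUsub
  rw [Finset.sum_const, smul_eq_mul] at hsum
  have hinsT : h = insideEdges G T := Finset.eq_of_subset_of_card_le hhT (by omega)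
  have hU : 𝒞.biUnion (cutEdges G) = cutEdges G T :=
    Finset.eq_of_subset_of_card_le hUsub (by omega)
  have hsingle : ∀ C ∈ 𝒞, #C ≤ 1 := by
    intro C hC
    have h6 := Finset.card_le_card (hHC C hC)
    refine hF.card_le_one_of_card_cutEdges (le_antisymm ?_ (hge C hC)) (by omega)
    by_contra! hlt
    have := Finset.sum_lt_sum hge ⟨C, hC, hlt⟩
    rw [Finset.sum_const, smul_eq_mul] at this
    omega
  have hcover : ∀ v, v ∈ T ∨ ∃ C ∈ 𝒞, v ∈ C := by
    by_contra! hZ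
    obtain ⟨z, hzT, hzC⟩ := hZ
    obtain ⟨x, hx⟩ := Finset.card_pos.1 (show 0 < #(vertsOf h) by omega)
    have h3 := three_le_card_cutEdges hF.cubic hF.threeConnected
      (X := (T ∪ 𝒞.biUnion id)ᶜ) ⟨z, by simpa [hzT] using hzC⟩
      ⟨x, by simp [hHT hx]⟩
    obtain ⟨e, he⟩ := Finset.card_pos.1 (by omega : 0 < #(cutEdges G (T ∪ 𝒞.biUnion id)ᶜ))
    obtain ⟨heG, a, ha, b, hb, rfl⟩ := Finset.mem_filter.1 he
    have hab := mk_mem_edgesOf.1 heG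
    simp only [Finset.mem_compl, Finset.mem_union, Finset.mem_biUnion, id, not_or,
      not_exists, not_and] at ha
    simp only [Finset.mem_compl, Finset.mem_union, Finset.mem_biUnion, id, not_not] at hb
    have hbT : b ∈ T := by
      refine hb.resolve_right ?_
      rintro ⟨C, hC, hbC⟩
      rcases hclosed C hC b hbC a hab.symm with haC | haT
      exacts [ha.2 C hC haC, ha.1 haT]
    have hcut : s(a, b) ∈ cutEdges G T := mk_mem_cutEdges.2 ⟨hab, Or.inr ⟨hbT, ha.1⟩⟩
    rw [← hU] at hcut
    obtain ⟨C, hC, hcut⟩ := Finset.mem_biUnion.1 hcut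
    rcases (mk_mem_cutEdges.1 hcut).2 with h | h
    exacts [ha.2 C hC h.1, hCT C hC b h.1 hbT]
  obtain ⟨p, hp, hp5, hpH⟩ := hF.exists_pentagon_disjoint hh hhex
  have hpT : p ⊆ cutEdges G T := by
    intro e he
    have heG := hF.face_subset hp he
    have hnot : e ∉ insideEdges G T := by
      rw [← hinsT]
      intro heh
      induction e with
      | _ a b =>
        exact hpH _ he a (Sym2.mem_mk_left _ _) (mem_vertsOf.2 ⟨_, heh, Sym2.mem_mk_left _ _⟩)
    induction e with
    | _ a b =>
      have hab := mk_mem_edgesOf.1 heG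
      rw [mk_mem_insideEdges] at hnot
      rw [mk_mem_cutEdges]
      refine ⟨hab, ?_⟩
      by_cases haT : a ∈ T
      · exact Or.inl ⟨haT, fun hbT => hnot ⟨hab, haT, hbT⟩⟩
      · obtain ⟨C, hC, haC⟩ := (hcover a).resolve_left haT
        refine Or.inr ⟨(hclosed C hC a haC b hab).resolve_left fun hbC => ?_, haT⟩
        exact hab.ne (Finset.card_le_one.1 (hsingle C hC) a haC b hbC)
  have heven := hF.even_card_inter_cutEdges hp T
  rw [Finset.inter_eq_left.2 hpT, hp5] at heven
  exact absurd heven (by decide)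

theorem hasPM_induce_compl (hF : IsFullerene G faces) {h : Finset (Sym2 V)} (hh : h ∈ faces)
    (hhex : #h = 6) :
    HasPM (G.induce {v | v ∉ vertsOf h}) := by
  classical
  by_contra hno
  have hH6 : #(vertsOf h) = 6 := (hF.card_vertsOf hh).trans hhex
  have heven : Even (Fintype.card {v | v ∉ vertsOf h}) := by
    have h3 := three_mul_card hF.cubic Finset.univ
    have hcut : cutEdges G Finset.univ = ∅ := by
      ext e
      induction e with
      | _ a b => simp [mk_mem_cutEdges]
    have hc : Fintype.card {v | v ∉ vertsOf h} + #(vertsOf h) = Fintype.card V := by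
      rw [← Finset.card_compl_add_card (vertsOf h), ← Set.toFinset_card]
      congr 2
      ext v
      simp
    rw [hcut, Finset.card_empty, Finset.card_univ] at h3
    rw [Nat.even_iff]
    omega
  obtain ⟨S, 𝒞, hcard, hne, hdis, hclosed⟩ := exists_components_of_not_hasPM _ heven hno
  let ι : {v | v ∉ vertsOf h} ↪ V := Function.Embedding.subtype _
  have hι : ∀ (X : Finset {v | v ∉ vertsOf h}) (v : V), v ∈ X.map ι → v ∉ vertsOf h := by
    intro X v hv
    obtain ⟨w, -, rfl⟩ := Finset.mem_map.1 hv
    exact w.2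
  have hlt := hF.card_components_lt hh hhex (S := S.map ι)
    (𝒞 := 𝒞.map (Finset.mapEmbedding ι).toEmbedding)
    (Finset.disjoint_left.2 (hι S)) ?_ ?_ ?_
  · rw [Finset.card_map, Finset.card_map] at hlt
    omega
  · intro C' hC'
    obtain ⟨C, hC, rfl⟩ := Finset.mem_map.1 hC'
    refine ⟨(hne C hC).1.map, Finset.disjoint_union_right.2 ⟨?_, Finset.disjoint_left.2 (hι C)⟩⟩
    exact (Finset.disjoint_map ι).2 (hne C hC).2
  · intro C' hC' D' hD' hCD
    obtain ⟨C, hC, rfl⟩ := Finset.mem_map.1 hC'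
    obtain ⟨D, hD, rfl⟩ := Finset.mem_map.1 hD'
    exact (Finset.disjoint_map ι).2 (hdis C hC D hD fun h => hCD (congrArg _ h))
  · intro C' hC' a' ha' b hab
    obtain ⟨C, hC, rfl⟩ := Finset.mem_map.1 hC'
    obtain ⟨a, ha, rfl⟩ := Finset.mem_map.1 ha'
    by_cases hb : b ∈ vertsOf h
    · exact Or.inr (Finset.mem_union_right _ hb)
    · rcases hclosed C hC a ha ⟨b, hb⟩ hab with hbC | hbS
      · exact Or.inl (Finset.mem_map.2 ⟨_, hbC, rfl⟩)
      · exact Or.inr (Finset.mem_union_left _ (Finset.mem_map.2 ⟨_, hbS, rfl⟩))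

/-- The vertices of a hexagon in cyclic order, with every other edge. -/
theorem exists_hexagon_matching (hF : IsFullerene G faces) {h : Finset (Sym2 V)} (hh : h ∈ faces)
    (hhex : #h = 6) :
    ∃ x : Fin 6 → V, Function.Injective x ∧ (∀ v, v ∈ vertsOf h ↔ ∃ i, x i = v) ∧
      s(x 0, x 1) ∈ h ∧ s(x 2, x 3) ∈ h ∧ s(x 4, x 5) ∈ h := by
  have hH6 : #(vertsOf h) = 6 := (hF.card_vertsOf hh).trans hhex
  obtain ⟨u, c, hc, hch⟩ := hF.face_cycle h hh
  have hlen : c.length = 6 := by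
    rw [← hhex, ← hch, List.toFinset_card_of_nodup hc.edges_nodup, Walk.length_edges]
  have hedge : ∀ i < 6, s(c.getVert i, c.getVert (i + 1)) ∈ h := by
    intro i hi
    rw [← hch, List.mem_toFinset]
    exact Walk.adj_toSubgraph_iff_mem_edges.1 (c.toSubgraph_adj_getVert (by omega))
  have hinj : Function.Injective fun i : Fin 6 => c.getVert i := by
    intro i j hij
    exact Fin.ext (hc.getVert_injOn' (by simp; omega) (by simp; omega) hij)
  refine ⟨fun i => c.getVert i, hinj, ?_, hedge 0 (by omega), hedge 2 (by omega),
    hedge 4 (by omega)⟩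
  have heq : Finset.univ.image (fun i : Fin 6 => c.getVert i) = vertsOf h := by
    refine Finset.eq_of_subset_of_card_le ?_ ?_
    · intro v hv
      obtain ⟨i, -, rfl⟩ := Finset.mem_image.1 hv
      exact mem_vertsOf.2 ⟨_, hedge i i.2, Sym2.mem_mk_left _ _⟩
    · rw [hH6, Finset.card_image_of_injective _ hinj]
      simp
  intro v
  rw [← heq]
  simp

end IsFullerene

/-- every hexagonal face of a fullerene graph is resonant. -/
theorem hexagon_resonant {V : Type*} [Fintype V] [DecidableEq V]
    (G : SimpleGraph V) (faces : Finset (Finset (Sym2 V)))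
    (hF : IsFullerene G faces)
    (h : Finset (Sym2 V)) (hh : h ∈ faces) (hhex : h.card = 6) :
    ∃ M : G.Subgraph, M.IsPerfectMatching ∧ AltFace G M h := by
  obtain ⟨N, hN⟩ := hF.hasPM_induce_compl hh hhex
  obtain ⟨x, hx, hxh, h01, h23, h45⟩ := hF.exists_hexagon_matching hh hhex
  rw [Subgraph.isPerfectMatching_iff] at hN
  have hG : ∀ a b, s(a, b) ∈ h → G.Adj a b := fun a b hab =>
    mk_mem_edgesOf.1 (hF.face_subset hh hab)
  let P : V → V → Prop := fun a b =>
    s(a, b) = s(x 0, x 1) ∨ s(a, b) = s(x 2, x 3) ∨ s(a, b) = s(x 4, x 5)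
  have hPh : ∀ a b, P a b → s(a, b) ∈ h := by
    rintro a b (hab | hab | hab) <;> rw [hab] <;> assumption
  have hPi : ∀ i, ∃! b, P (x i) b := by
    have hP : ∀ i a, P (x i) a → ∃ j, x j = a := fun i a ha =>
      (hxh a).1 (mem_vertsOf.2 ⟨_, hPh _ _ ha, Sym2.mem_mk_right _ _⟩)
    have hfin : ∀ i : Fin 6, ∃! j : Fin 6,
        s(i, j) = s(0, 1) ∨ s(i, j) = s(2, 3) ∨ s(i, j) = s(4, 5) := by
      unfold ExistsUnique
      decide
    have htr : ∀ i j, P (x i) (x j) ↔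
        (s(i, j) = s(0, 1) ∨ s(i, j) = s(2, 3) ∨ s(i, j) = s(4, 5)) := by
      intro i j
      simp only [P, Sym2.eq_iff, hx.eq_iff]
    intro i
    obtain ⟨j, hj, huniq⟩ := hfin i
    refine ⟨x j, (htr i j).2 hj, fun a ha => ?_⟩
    obtain ⟨k, rfl⟩ := hP i a ha
    rw [huniq k ((htr i k).1 ha)]
  let M : G.Subgraph :=
    { verts := Set.univ
      Adj := fun a b => (∃ ha hb, N.Adj ⟨a, ha⟩ ⟨b, hb⟩) ∨ P a b
      adj_sub := by
        rintro a b (⟨ha, hb, hab⟩ | hab)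
        · exact N.adj_sub hab
        · exact hG _ _ (hPh _ _ hab)
      edge_vert := fun _ => Set.mem_univ _
      symm := by
        constructor
        rintro a b (⟨ha, hb, hab⟩ | hab)
        · exact Or.inl ⟨hb, ha, hab.symm⟩
        · right
          simp only [P, Sym2.eq_swap (a := b)]
          exact hab }
  refine ⟨M, Subgraph.isPerfectMatching_iff.2 fun v => ?_, fun v hv => ?_⟩
  · by_cases hv : v ∈ vertsOf h
    · obtain ⟨i, rfl⟩ := (hxh v).1 hv
      obtain ⟨b, hb, huniq⟩ := hPi i
      refine ⟨b, Or.inr hb, ?_⟩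
      rintro a (⟨ha, -⟩ | ha)
      exacts [absurd hv ha, huniq a ha]
    · obtain ⟨w, hw, huniq⟩ := hN ⟨v, hv⟩
      refine ⟨w, Or.inl ⟨hv, w.2, hw⟩, ?_⟩
      rintro a (⟨_, ha, hva⟩ | hva)
      · exact congrArg Subtype.val (huniq ⟨a, ha⟩ hva)
      · exact absurd (mem_vertsOf.2 ⟨_, hPh _ _ hva, Sym2.mem_mk_left _ _⟩) hv
  · obtain ⟨i, rfl⟩ := (hxh v).1 (mem_vertsOf.2 hv)
    obtain ⟨b, hb, -⟩ := hPi i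
    exact ⟨b, hPh _ _ hb, Or.inr hb⟩
end

section
/- Every 3-resonant fullerene graph has at most 60 vertices. -/
open SimpleGraph

/-- A set of (disjoint hexagonal) faces is a resonant pattern if some perfect matching
of `G` is alternating on all of them. -/
def IsResonantPattern (G : SimpleGraph V) (H : Finset (Finset (Sym2 V))) : Prop :=
  ∃ M : G.Subgraph, M.IsPerfectMatching ∧ ∀ f ∈ H, AltFace G M f

/-- `G` (with face set `faces`) is `k`-resonant. -/
def KResonant [Fintype V] [DecidableEq V] (G : SimpleGraph V)
    (faces : Finset (Finset (Sym2 V))) (k : ℕ) : Prop :=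
  ∀ H : Finset (Finset (Sym2 V)), H ⊆ faces → (∀ f ∈ H, f.card = 6) →
    (∀ f ∈ H, ∀ g ∈ H, f ≠ g → Disjoint (faceVerts f) (faceVerts g)) →
    H.card ≤ k → IsResonantPattern G H

namespace ThreeResonant

open Finset Matrix

theorem rank_lower_bound {α β K : Type*} [Fintype α] [Fintype β] [DecidableEq α] [Field K]
    (M : Matrix β α K)
    (hM : ∀ x, M *ᵥ x = 0 → ∃ c : K, x = fun _ => c) :
    Fintype.card α ≤ M.rank + 1 := by
  have h := LinearMap.finrank_range_add_finrank_ker M.mulVecLin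
  have hker : Module.finrank K (LinearMap.ker M.mulVecLin) ≤ 1 := by
    have hle : LinearMap.ker M.mulVecLin ≤ Submodule.span K {fun _ => (1 : K)} := by
      intro x hx
      obtain ⟨c, rfl⟩ := hM x (by simpa using hx)
      rw [Submodule.mem_span_singleton]
      exact ⟨c, by ext; simp⟩
    refine (Submodule.finrank_mono hle).trans ?_
    exact (finrank_span_le_card _).trans (by simp)
  rw [Module.finrank_fintype_fun_eq_card] at h
  rw [Matrix.rank]
  omega

theorem card_add_card_le {α β γ K : Type*} [Fintype α] [Fintype β] [Fintype γ]
    [DecidableEq α] [DecidableEq γ] [Field K] (M : Matrix β α K) (N : Matrix γ β K)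
    (hNM : N * M = 0) (hM : ∀ x, M *ᵥ x = 0 → ∃ c : K, x = fun _ => c)
    (hN : ∀ y, Nᵀ *ᵥ y = 0 → y = 0) :
    Fintype.card α + Fintype.card γ ≤ Fintype.card β + 1 := by
  have h₁ := rank_lower_bound M hM
  have h₂ := LinearMap.finrank_range_add_finrank_ker Nᵀ.mulVecLin
  have hker : LinearMap.ker Nᵀ.mulVecLin = ⊥ := by
    rw [LinearMap.ker_eq_bot']
    intro y hy
    exact hN y hy
  rw [hker, finrank_bot, Module.finrank_fintype_fun_eq_card] at h₂
  change Nᵀ.rank + 0 = _ at h₂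
  rw [Matrix.rank_transpose] at h₂
  have h₃ := Matrix.rank_add_rank_le_card_of_mul_eq_zero hNM
  omega

theorem exists_mulVec_eq_of_mulVec_eq_zero {α β γ K : Type*} [Fintype α] [Fintype β] [Fintype γ]
    [DecidableEq α] [DecidableEq γ] [Field K] (M : Matrix β α K) (N : Matrix γ β K)
    (hNM : N * M = 0) (hM : ∀ x, M *ᵥ x = 0 → ∃ c : K, x = fun _ => c)
    (hN : ∀ y, Nᵀ *ᵥ y = 0 → ∃ c : K, y = fun _ => c)
    (hcard : Fintype.card α + Fintype.card γ = Fintype.card β + 2)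
    (d : β → K) (hd : N *ᵥ d = 0) : ∃ x, M *ᵥ x = d := by
  have h₁ := rank_lower_bound M hM
  have h₂ := rank_lower_bound Nᵀ hN
  rw [Matrix.rank_transpose] at h₂
  have h₃ := LinearMap.finrank_range_add_finrank_ker N.mulVecLin
  rw [Module.finrank_fintype_fun_eq_card] at h₃
  change N.rank + _ = _ at h₃
  have hle : LinearMap.range M.mulVecLin ≤ LinearMap.ker N.mulVecLin := by
    rintro _ ⟨x, rfl⟩
    simp [hNM]
  have heq := Submodule.eq_of_le_of_finrank_le hle (by
    change _ ≤ M.rank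
    omega)
  have hmem : d ∈ LinearMap.range M.mulVecLin := by
    rw [heq]
    simpa using hd
  simpa using hmem

variable {V : Type*} [DecidableEq V]

/-- The edges of `X` incident with `v`. -/
def edgesAt (X : Finset (Sym2 V)) (v : V) : Finset (Sym2 V) := {e ∈ X | v ∈ e}

theorem edgesAt_mono {X Y : Finset (Sym2 V)} (hXY : X ⊆ Y) (v : V) : edgesAt X v ⊆ edgesAt Y v :=
  filter_subset_filter _ hXY

/-- The faces through the vertex `v`. -/
def facesAt (faces : Finset (Finset (Sym2 V))) (v : V) : Finset (Finset (Sym2 V)) :=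
  {f ∈ faces | (edgesAt f v).Nonempty}

theorem faces_subset_facesAt {faces : Finset (Finset (Sym2 V))} {e : Sym2 V} {v : V} (hv : v ∈ e) :
    {f ∈ faces | e ∈ f} ⊆ facesAt faces v := by
  intro f hf
  simp only [mem_filter] at hf
  simp only [facesAt, mem_filter]
  exact ⟨hf.1, e, mem_filter.2 ⟨hf.2, hv⟩⟩

theorem card_edgesAt_eq_ncard {X : Finset (Sym2 V)} {v : V} {N : Set V}
    (hN : ∀ u, u ∈ N ↔ s(v, u) ∈ X) : #(edgesAt X v) = N.ncard := by
  have himage : (edgesAt X v : Set (Sym2 V)) = (fun u => s(v, u)) '' N := by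
    ext e
    simp only [edgesAt, coe_filter, Set.mem_ofPred_eq, Set.mem_image]
    constructor
    · rintro ⟨he, hv⟩
      obtain ⟨u, rfl⟩ := Sym2.mem_iff_exists.1 hv
      exact ⟨u, (hN u).2 he, rfl⟩
    · rintro ⟨u, hu, rfl⟩
      exact ⟨(hN u).1 hu, Sym2.mem_mk_left v u⟩
  rw [← Set.ncard_coe_finset, himage,
    Set.ncard_image_of_injective _ fun a b hab => Sym2.congr_right.1 hab]

theorem mem_faceVerts_iff {f : Finset (Sym2 V)} {v : V} :
    v ∈ faceVerts f ↔ (edgesAt f v).Nonempty := by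
  simp [faceVerts, edgesAt, Finset.Nonempty]

variable [Fintype V]

/-- The edges of `X` with both ends in `A`. -/
def edgesIn (X : Finset (Sym2 V)) (A : Finset V) : Finset (Sym2 V) := {e ∈ X | ∀ v ∈ e, v ∈ A}

/-- The edges of `X` with exactly one end in `A`. -/
def cutEdges (X : Finset (Sym2 V)) (A : Finset V) : Finset (Sym2 V) :=
  {e ∈ X | (∃ v ∈ e, v ∈ A) ∧ ∃ v ∈ e, v ∉ A}

theorem mk_mem_edgesIn {X : Finset (Sym2 V)} {A : Finset V} {x y : V} :
    s(x, y) ∈ edgesIn X A ↔ s(x, y) ∈ X ∧ x ∈ A ∧ y ∈ A := by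
  simp [edgesIn]

theorem mk_mem_cutEdges {X : Finset (Sym2 V)} {A : Finset V} {x y : V} :
    s(x, y) ∈ cutEdges X A ↔ s(x, y) ∈ X ∧ (x ∈ A ∧ y ∉ A ∨ x ∉ A ∧ y ∈ A) := by
  simp only [cutEdges, mem_filter, Sym2.mem_iff]
  grind

theorem cutEdges_subset (X : Finset (Sym2 V)) (A : Finset V) : cutEdges X A ⊆ X :=
  filter_subset _ _

theorem cutEdges_compl (X : Finset (Sym2 V)) (A : Finset V) :
    cutEdges X Aᶜ = cutEdges X A := by
  ext e
  simp only [cutEdges, mem_filter, mem_compl]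
  tauto

theorem sum_card_edgesAt {X : Finset (Sym2 V)} (hX : ∀ e ∈ X, ¬ e.IsDiag) (A : Finset V) :
    ∑ v ∈ A, #(edgesAt X v) = 2 * #(edgesIn X A) + #(cutEdges X A) := by
  have h := sum_card_bipartiteAbove_eq_sum_card_bipartiteBelow (s := A) (t := X)
    (fun v e => v ∈ e)
  simp only [bipartiteAbove, bipartiteBelow] at h
  simp only [edgesAt, edgesIn, cutEdges]
  rw [h, card_filter, card_filter, mul_sum, ← sum_add_distrib]
  refine sum_congr rfl fun e he => ?_
  induction e using Sym2.ind with
  | _ x y =>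
    have hxy : x ≠ y := fun h => hX _ he (by simpa using h)
    have hfil : ({v ∈ A | v ∈ s(x, y)} : Finset V) = ({x, y} : Finset V).filter (· ∈ A) := by
      ext v
      simp [and_comm]
    rw [hfil, filter_insert, filter_singleton]
    by_cases hx : x ∈ A <;> by_cases hy : y ∈ A <;> simp [hx, hy, hxy]

theorem sum_card_edgesAt_cutEdges {X : Finset (Sym2 V)} (hX : ∀ e ∈ X, ¬ e.IsDiag)
    (A : Finset V) : ∑ v ∈ A, #(edgesAt (cutEdges X A) v) = #(cutEdges X A) := by
  have h1 : edgesIn (cutEdges X A) A = ∅ := by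
    refine filter_false_of_mem fun e he hin => ?_
    obtain ⟨-, -, v, hv, hvA⟩ := mem_filter.1 he
    exact hvA (hin v hv)
  have h2 : cutEdges (cutEdges X A) A = cutEdges X A :=
    filter_true_of_mem fun e he => (mem_filter.1 he).2
  rw [sum_card_edgesAt (fun e he => hX e (cutEdges_subset X A he)) A, h1, h2]
  simp

theorem card_edgesIn_add_card_edgesIn_compl_add_card_cutEdges (X : Finset (Sym2 V))
    (A : Finset V) : #(edgesIn X A) + #(edgesIn X Aᶜ) + #(cutEdges X A) = #X := by
  simp only [edgesIn, cutEdges, card_filter]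
  rw [← sum_add_distrib, ← sum_add_distrib, card_eq_sum_ones]
  refine sum_congr rfl fun e he => ?_
  induction e using Sym2.ind with
  | _ x y =>
    by_cases hx : x ∈ A <;> by_cases hy : y ∈ A <;> simp [hx, hy]

/-- The combinatorial data of a fullerene used below: a cubic, 3-edge-connected graph with edge
set `E`, cellularly decomposing the sphere into pentagons and hexagons. -/
structure IsSphericalMap (E : Finset (Sym2 V)) (faces : Finset (Finset (Sym2 V))) : Prop where
  not_isDiag : ∀ e ∈ E, ¬ e.IsDiag
  card_edgesAt : ∀ v, #(edgesAt E v) = 3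
  three_le_cut : ∀ A : Finset V, A.Nonempty → A ≠ univ → 3 ≤ #(cutEdges E A)
  face_subset : ∀ f ∈ faces, f ⊆ E
  card_edgesAt_face : ∀ f ∈ faces, ∀ v, (edgesAt f v).Nonempty → #(edgesAt f v) = 2
  face_connected : ∀ f ∈ faces, ∀ A, cutEdges f A = ∅ →
    (∀ e ∈ f, ∀ v ∈ e, v ∈ A) ∨ ∀ e ∈ f, ∀ v ∈ e, v ∉ A
  card_face : ∀ f ∈ faces, #f = 5 ∨ #f = 6
  card_faces_edge : ∀ e ∈ E, #{f ∈ faces | e ∈ f} = 2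
  euler : Fintype.card V + #faces = #E + 2

/-- The faces all of whose vertices lie in `A`. -/
def facesIn (faces : Finset (Finset (Sym2 V))) (A : Finset V) : Finset (Finset (Sym2 V)) :=
  {f ∈ faces | ∀ e ∈ f, ∀ v ∈ e, v ∈ A}

/-- The faces having vertices both inside and outside `A`. -/
def facesCrossing (faces : Finset (Finset (Sym2 V))) (A : Finset V) :
    Finset (Finset (Sym2 V)) :=
  {f ∈ faces | (cutEdges f A).Nonempty}

/-- The number of edges inside `A`, counted once for every face containing them
that crosses the boundary of `A`. -/
def boundaryLength (faces : Finset (Finset (Sym2 V))) (A : Finset V) : ℕ :=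
  ∑ f ∈ facesCrossing faces A, #(edgesIn f A)

/-- The pentagons inside `A`. -/
def pentagonsIn (faces : Finset (Finset (Sym2 V))) (A : Finset V) : Finset (Finset (Sym2 V)) :=
  {f ∈ facesIn faces A | #f = 5}

namespace IsSphericalMap

variable {E : Finset (Sym2 V)} {faces : Finset (Finset (Sym2 V))}

theorem edgesAt_face_subset (h : IsSphericalMap E faces) {f : Finset (Sym2 V)} (hf : f ∈ faces)
    (v : V) : edgesAt f v ⊆ edgesAt E v :=
  edgesAt_mono (h.face_subset f hf) v

theorem even_card_edgesAt (h : IsSphericalMap E faces) {f : Finset (Sym2 V)} (hf : f ∈ faces)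
    (v : V) : Even #(edgesAt f v) := by
  rcases (edgesAt f v).eq_empty_or_nonempty with h0 | h0
  · simp [h0]
  · simp [h.card_edgesAt_face f hf v h0]

theorem card_facesAt (h : IsSphericalMap E faces) (v : V) : #(facesAt faces v) = 3 := by
  have hd := sum_card_bipartiteAbove_eq_sum_card_bipartiteBelow (s := faces) (t := edgesAt E v)
    (fun f e => e ∈ f)
  simp only [bipartiteAbove, bipartiteBelow] at hd
  rw [sum_congr rfl (s₁ := edgesAt E v) (g := fun _ => 2)
    fun e he => h.card_faces_edge e (mem_filter.1 he).1] at hd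
  rw [sum_congr rfl (g := fun f => if (edgesAt f v).Nonempty then 2 else 0)] at hd
  · rw [← sum_filter, sum_const, sum_const, h.card_edgesAt] at hd
    simp only [facesAt]
    simp only [smul_eq_mul] at hd
    omega
  · intro f hf
    have heq : {e ∈ edgesAt E v | e ∈ f} = edgesAt f v := by
      ext e
      have := @h.face_subset f hf e
      simp only [edgesAt, mem_filter]
      tauto
    rw [heq]
    split_ifs with h0
    · exact h.card_edgesAt_face f hf v h0
    · simpa [not_nonempty_iff_eq_empty] using h0

theorem exists_common_edge (h : IsSphericalMap E faces) {f g : Finset (Sym2 V)} {v : V}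
    (hf : f ∈ facesAt faces v) (hg : g ∈ facesAt faces v) : ∃ e ∈ f, e ∈ g ∧ v ∈ e := by
  obtain ⟨hf, hf0⟩ := mem_filter.1 hf
  obtain ⟨hg, hg0⟩ := mem_filter.1 hg
  have h1 := card_union_add_card_inter (edgesAt f v) (edgesAt g v)
  have h2 := card_le_card (union_subset (h.edgesAt_face_subset hf v) (h.edgesAt_face_subset hg v))
  rw [h.card_edgesAt_face f hf v hf0, h.card_edgesAt_face g hg v hg0] at h1
  rw [h.card_edgesAt] at h2
  obtain ⟨e, he⟩ := card_pos.1 (show 0 < #(edgesAt f v ∩ edgesAt g v) by omega)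
  simp only [edgesAt, mem_inter, mem_filter] at he
  exact ⟨e, he.1.1, he.2.1, he.1.2⟩

theorem exists_common_face (h : IsSphericalMap E faces) {e₁ e₂ : Sym2 V} {v : V}
    (h₁ : e₁ ∈ edgesAt E v) (h₂ : e₂ ∈ edgesAt E v) : ∃ f ∈ faces, e₁ ∈ f ∧ e₂ ∈ f := by
  simp only [edgesAt, mem_filter] at h₁ h₂
  have h3 := card_union_add_card_inter {f ∈ faces | e₁ ∈ f} {f ∈ faces | e₂ ∈ f}
  have h4 := card_le_card (union_subset (faces_subset_facesAt (faces := faces) h₁.2)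
    (faces_subset_facesAt (faces := faces) h₂.2))
  rw [h.card_facesAt] at h4
  rw [h.card_faces_edge _ h₁.1, h.card_faces_edge _ h₂.1] at h3
  obtain ⟨f, hf⟩ := card_pos.1 (show 0 < #({f ∈ faces | e₁ ∈ f} ∩ {f ∈ faces | e₂ ∈ f}) by omega)
  simp only [mem_inter, mem_filter] at hf
  exact ⟨f, hf.1.1, hf.1.2, hf.2.2⟩

theorem exists_face_avoiding (h : IsSphericalMap E faces) {e : Sym2 V} {v : V}
    (he : e ∈ edgesAt E v) : ∃ f ∈ facesAt faces v, e ∉ f := by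
  simp only [edgesAt, mem_filter] at he
  by_contra! hcon
  have hle : facesAt faces v ⊆ {f ∈ faces | e ∈ f} := fun f hf =>
    mem_filter.2 ⟨(mem_filter.1 hf).1, hcon f hf⟩
  have := card_le_card hle
  rw [h.card_facesAt, h.card_faces_edge e he.1] at this
  omega

theorem even_card_cutEdges (h : IsSphericalMap E faces) {f : Finset (Sym2 V)} (hf : f ∈ faces)
    (A : Finset V) : Even #(cutEdges f A) := by
  have hs := sum_card_edgesAt (fun e he => h.not_isDiag e (h.face_subset f hf he)) A
  have he : Even (∑ v ∈ A, #(edgesAt f v)) := even_sum _ fun v _ => h.even_card_edgesAt hf v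
  rw [hs] at he
  simpa [Nat.even_add] using he

theorem mem_facesIn_or (h : IsSphericalMap E faces) {f : Finset (Sym2 V)} (hf : f ∈ faces)
    (A : Finset V) : f ∈ facesIn faces A ∨ f ∈ facesIn faces Aᶜ ∨ f ∈ facesCrossing faces A := by
  rcases (cutEdges f A).eq_empty_or_nonempty with h0 | h0
  · rcases h.face_connected f hf A h0 with h1 | h1
    · exact Or.inl (mem_filter.2 ⟨hf, h1⟩)
    · exact Or.inr (Or.inl (mem_filter.2 ⟨hf, by simpa using h1⟩))
  · exact Or.inr (Or.inr (mem_filter.2 ⟨hf, h0⟩))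

theorem edgesIn_of_mem_facesIn {f : Finset (Sym2 V)} {A : Finset V} (hf : f ∈ facesIn faces A) :
    edgesIn f A = f :=
  filter_true_of_mem (mem_filter.1 hf).2

theorem cutEdges_of_mem_facesIn {f : Finset (Sym2 V)} {A : Finset V} (hf : f ∈ facesIn faces A) :
    cutEdges f A = ∅ := by
  refine filter_false_of_mem ?_
  rintro e he ⟨-, v, hv, hvA⟩
  exact hvA ((mem_filter.1 hf).2 e he v hv)

theorem face_nonempty (h : IsSphericalMap E faces) {f : Finset (Sym2 V)} (hf : f ∈ faces) :
    f.Nonempty := by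
  rw [← card_pos]
  rcases h.card_face f hf with h | h <;> omega

theorem edgesIn_of_mem_facesIn_compl {f : Finset (Sym2 V)} {A : Finset V}
    (hf : f ∈ facesIn faces Aᶜ) : edgesIn f A = ∅ := by
  refine filter_false_of_mem fun e he hA => ?_
  induction e using Sym2.ind with
  | _ x y =>
    exact mem_compl.1 ((mem_filter.1 hf).2 _ he x (Sym2.mem_mk_left x y))
      (hA x (Sym2.mem_mk_left x y))

theorem sum_faces (h : IsSphericalMap E faces) (A : Finset V) (w : Finset (Sym2 V) → ℕ) :
    ∑ f ∈ faces, w f = ∑ f ∈ facesIn faces A, w f + ∑ f ∈ facesIn faces Aᶜ, w f +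
      ∑ f ∈ facesCrossing faces A, w f := by
  have hdis : Disjoint (facesIn faces A) (facesIn faces Aᶜ) := by
    rw [Finset.disjoint_left]
    intro f hf hf'
    have h1 := edgesIn_of_mem_facesIn hf
    rw [edgesIn_of_mem_facesIn_compl hf'] at h1
    exact (h.face_nonempty (mem_filter.1 hf).1).ne_empty h1.symm
  have hdis' : Disjoint (facesIn faces A ∪ facesIn faces Aᶜ) (facesCrossing faces A) := by
    rw [Finset.disjoint_left]
    intro f hf hf'
    refine (mem_filter.1 hf').2.ne_empty ?_
    rcases mem_union.1 hf with hf | hf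
    · exact cutEdges_of_mem_facesIn hf
    · rw [← cutEdges_compl]
      exact cutEdges_of_mem_facesIn hf
  rw [← sum_union hdis, ← sum_union hdis']
  congr 1
  ext f
  simp only [mem_union]
  refine ⟨fun hf => by have := h.mem_facesIn_or hf A; tauto, ?_⟩
  rintro ((hf | hf) | hf) <;> exact (mem_filter.1 hf).1

theorem sum_card_inter (h : IsSphericalMap E faces) {X : Finset (Sym2 V)} (hX : X ⊆ E) :
    ∑ f ∈ faces, #{e ∈ X | e ∈ f} = 2 * #X := by
  have hd := sum_card_bipartiteAbove_eq_sum_card_bipartiteBelow (s := faces) (t := X)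
    (fun f e => e ∈ f)
  simp only [bipartiteAbove, bipartiteBelow] at hd
  rw [hd, sum_congr rfl fun e he => h.card_faces_edge e (hX he), sum_const, smul_eq_mul, mul_comm]

theorem card_cutEdges_of_crossing (h : IsSphericalMap E faces) {A : Finset V}
    (hA : #(cutEdges E A) = 3) {f : Finset (Sym2 V)} (hf : f ∈ facesCrossing faces A) :
    #(cutEdges f A) = 2 := by
  obtain ⟨hf, h0⟩ := mem_filter.1 hf
  have h1 := card_pos.2 h0
  have h2 := h.even_card_cutEdges hf A
  have h3 := card_le_card (filter_subset_filter
    (fun e => (∃ v ∈ e, v ∈ A) ∧ ∃ v ∈ e, v ∉ A) (h.face_subset f hf))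
  change #(cutEdges f A) ≤ #(cutEdges E A) at h3
  rcases h2 with ⟨k, hk⟩
  omega

theorem card_facesCrossing (h : IsSphericalMap E faces) {A : Finset V}
    (hA : #(cutEdges E A) = 3) : #(facesCrossing faces A) = 3 := by
  have hs := h.sum_card_inter (X := cutEdges E A) (filter_subset _ _)
  have hcut : ∀ f ∈ faces, {e ∈ cutEdges E A | e ∈ f} = cutEdges f A := by
    intro f hf
    ext e
    have := @h.face_subset f hf e
    simp only [cutEdges, mem_filter]
    tauto
  rw [sum_congr rfl fun f hf => congrArg card (hcut f hf), h.sum_faces A,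
    sum_congr rfl (s₁ := facesCrossing faces A) fun f hf => h.card_cutEdges_of_crossing hA hf,
    sum_congr rfl (s₁ := facesIn faces A) (g := fun _ => 0)
      (fun f hf => by simp [cutEdges_of_mem_facesIn hf]),
    sum_congr rfl (s₁ := facesIn faces Aᶜ) (g := fun _ => 0)
      (fun f hf => by rw [← cutEdges_compl]; simp [cutEdges_of_mem_facesIn hf]), hA] at hs
  simp at hs
  omega

theorem sum_card_facesIn_add_boundaryLength (h : IsSphericalMap E faces) (A : Finset V) :
    ∑ f ∈ facesIn faces A, #f + boundaryLength faces A = 2 * #(edgesIn E A) := by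
  have hs := h.sum_card_inter (X := edgesIn E A) (filter_subset _ _)
  have hin : ∀ f ∈ faces, {e ∈ edgesIn E A | e ∈ f} = edgesIn f A := by
    intro f hf
    ext e
    have := @h.face_subset f hf e
    simp only [edgesIn, mem_filter]
    tauto
  rw [sum_congr rfl fun f hf => congrArg card (hin f hf), h.sum_faces A,
    sum_congr rfl (s₁ := facesIn faces A) (g := fun f => #f)
      (fun f hf => by rw [edgesIn_of_mem_facesIn hf]),
    sum_congr rfl (s₁ := facesIn faces Aᶜ) (g := fun _ => 0)
      (fun f hf => by simp [edgesIn_of_mem_facesIn_compl hf])] at hs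
  simpa [boundaryLength] using hs

theorem sum_card_facesIn_add_pentagonsIn (h : IsSphericalMap E faces) (A : Finset V) :
    ∑ f ∈ facesIn faces A, #f + #(pentagonsIn faces A) = 6 * #(facesIn faces A) := by
  rw [pentagonsIn, card_filter, ← sum_add_distrib, sum_congr rfl (g := fun _ => 6), sum_const,
    smul_eq_mul, mul_comm]
  intro f hf
  rcases h.card_face f (mem_filter.1 hf).1 with h5 | h6
  · simp [h5]
  · simp [h6]

theorem boundaryLength_add_compl_le (h : IsSphericalMap E faces) {A : Finset V}
    (hA : #(cutEdges E A) = 3) : boundaryLength faces A + boundaryLength faces Aᶜ ≤ 12 := by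
  have hc : facesCrossing faces Aᶜ = facesCrossing faces A := by
    simp only [facesCrossing, cutEdges_compl]
  rw [boundaryLength, boundaryLength, hc, ← sum_add_distrib]
  refine (sum_le_card_nsmul _ _ 4 fun f hf => ?_).trans (by rw [h.card_facesCrossing hA]; norm_num)
  have h1 := card_edgesIn_add_card_edgesIn_compl_add_card_cutEdges f A
  rw [h.card_cutEdges_of_crossing hA hf] at h1
  rcases h.card_face f (mem_filter.1 hf).1 with h2 | h2 <;> omega

theorem eq_empty_or_eq_faces (h : IsSphericalMap E faces) {X : Finset (Finset (Sym2 V))}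
    (hX : X ⊆ faces) (heven : ∀ e ∈ E, Even #{f ∈ X | e ∈ f}) : X = ∅ ∨ X = faces := by
  have hedge : ∀ e f g, e ∈ f → f ∈ X → e ∈ g → g ∈ faces → g ∈ X := by
    intro e f g hef hf heg hg
    have heE := h.face_subset g hg heg
    have hsub : {f ∈ X | e ∈ f} ⊆ {f ∈ faces | e ∈ f} := filter_subset_filter _ hX
    have h1 := h.card_faces_edge e heE
    have h2 : 0 < #{f ∈ X | e ∈ f} := card_pos.2 ⟨f, mem_filter.2 ⟨hf, hef⟩⟩
    obtain ⟨k, hk⟩ := heven e heE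
    have h3 := card_le_card hsub
    have heq := eq_of_subset_of_card_le hsub (by omega)
    have hmem : g ∈ {f ∈ faces | e ∈ f} := mem_filter.2 ⟨hg, heg⟩
    rw [← heq] at hmem
    exact (mem_filter.1 hmem).1
  have hvertex : ∀ v f, f ∈ X → (edgesAt f v).Nonempty → facesAt faces v ⊆ X := by
    intro v f hf hv g hg
    obtain ⟨e, hef, heg, -⟩ := h.exists_common_edge (mem_filter.2 ⟨hX hf, hv⟩) hg
    exact hedge e f g hef hf heg (mem_filter.1 hg).1
  rcases X.eq_empty_or_nonempty with h0 | ⟨f₀, hf₀⟩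
  · exact Or.inl h0
  right
  set W : Finset V := {v | ∃ f ∈ X, (edgesAt f v).Nonempty} with hW
  have hcut : cutEdges E W = ∅ := by
    refine filter_false_of_mem ?_
    rintro e he ⟨⟨v, hv, hvW⟩, u, hu, huW⟩
    refine huW ?_
    obtain ⟨f, hf, hfv⟩ := (mem_filter.1 hvW).2
    obtain ⟨g, hg⟩ := card_pos.1 (show 0 < #{f ∈ faces | e ∈ f} by
      rw [h.card_faces_edge e he]; norm_num)
    refine mem_filter.2 ⟨mem_univ _, g, hvertex v f hf hfv (faces_subset_facesAt hv hg), e, ?_⟩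
    exact mem_filter.2 ⟨(mem_filter.1 hg).2, hu⟩
  have hvtx : ∀ f ∈ faces, ∃ v, (edgesAt f v).Nonempty := by
    intro f hf
    obtain ⟨e, he⟩ := h.face_nonempty hf
    induction e using Sym2.ind with
    | _ x y => exact ⟨x, s(x, y), mem_filter.2 ⟨he, Sym2.mem_mk_left x y⟩⟩
  have hWne : W.Nonempty := by
    obtain ⟨v, hv⟩ := hvtx f₀ (hX hf₀)
    exact ⟨v, mem_filter.2 ⟨mem_univ _, f₀, hf₀, hv⟩⟩
  have hWuniv : W = univ := by
    by_contra hne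
    have := h.three_le_cut W hWne hne
    simp [hcut] at this
  refine Subset.antisymm hX fun g hg => ?_
  obtain ⟨v, hv⟩ := hvtx g hg
  obtain ⟨f, hf, hfv⟩ := (mem_filter.1 (hWuniv ▸ mem_univ v : v ∈ W)).2
  exact hvertex v f hf hfv (mem_filter.2 ⟨hg, hv⟩)

/-- The incidence matrix over `ZMod 2` between the edges and the vertices inside `A`. -/
def edgeVertexMatrix (E : Finset (Sym2 V)) (A : Finset V) :
    Matrix (edgesIn E A) A (ZMod 2) :=
  Matrix.of fun e v => if v.1 ∈ e.1 then 1 else 0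

/-- The incidence matrix over `ZMod 2` between the faces and the edges inside `A`. -/
def faceEdgeMatrix (E : Finset (Sym2 V)) (faces : Finset (Finset (Sym2 V))) (A : Finset V) :
    Matrix (facesIn faces A) (edgesIn E A) (ZMod 2) :=
  Matrix.of fun f e => if e.1 ∈ f.1 then 1 else 0

theorem edgeVertexMatrix_mulVec (h : IsSphericalMap E faces) {A : Finset V} (z : A → ZMod 2)
    {x y : V} (he : s(x, y) ∈ edgesIn E A) :
    (edgeVertexMatrix E A *ᵥ z) ⟨s(x, y), he⟩ =
      z ⟨x, (mk_mem_edgesIn.1 he).2.1⟩ + z ⟨y, (mk_mem_edgesIn.1 he).2.2⟩ := by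
  have hxy : x ≠ y := fun hxy => h.not_isDiag _ (mem_filter.1 he).1 (by simpa using hxy)
  simp only [Matrix.mulVec, dotProduct, edgeVertexMatrix, Matrix.of_apply]
  rw [sum_congr rfl (g := fun v => (if v = ⟨x, (mk_mem_edgesIn.1 he).2.1⟩ then z v else 0) +
    if v = ⟨y, (mk_mem_edgesIn.1 he).2.2⟩ then z v else 0)]
  · simp [sum_add_distrib]
  · rintro ⟨v, hv⟩ -
    simp only [Sym2.mem_iff, Subtype.mk.injEq]
    by_cases h1 : v = x <;> by_cases h2 : v = y <;> simp_all

theorem faceEdgeMatrix_mul_edgeVertexMatrix (h : IsSphericalMap E faces) (A : Finset V) :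
    faceEdgeMatrix E faces A * edgeVertexMatrix E A = 0 := by
  ext ⟨f, hf⟩ ⟨v, hv⟩
  simp only [Matrix.mul_apply, faceEdgeMatrix, edgeVertexMatrix, Matrix.of_apply,
    Matrix.zero_apply]
  rw [sum_coe_sort (edgesIn E A)
    (fun e => (if e ∈ f then (1 : ZMod 2) else 0) * if v ∈ e then 1 else 0)]
  have heq : ∀ e ∈ edgesIn E A, ((if e ∈ f then (1 : ZMod 2) else 0) * if v ∈ e then 1 else 0) =
      if e ∈ f ∧ v ∈ e then 1 else 0 := by
    intro e _
    by_cases h1 : e ∈ f <;> by_cases h2 : v ∈ e <;> simp [h1, h2]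
  rw [sum_congr rfl heq, ← sum_filter, sum_const, nsmul_one]
  have hset : {e ∈ edgesIn E A | e ∈ f ∧ v ∈ e} = edgesAt f v := by
    ext e
    obtain ⟨hf, hfA⟩ := mem_filter.1 hf
    have h1 := @h.face_subset f hf e
    have h2 := hfA e
    simp only [edgesIn, edgesAt, mem_filter]
    tauto
  rw [hset]
  exact (ZMod.natCast_eq_zero_iff_even).2 (h.even_card_edgesAt (mem_filter.1 hf).1 v)

theorem exists_edge_of_ssubset (h : IsSphericalMap E faces) {A W : Finset V}
    (hA : #(cutEdges E A) ≤ 3) (hW : W.Nonempty) (hWA : W ⊂ A) :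
    ∃ x ∈ W, ∃ y ∈ A, y ∉ W ∧ s(x, y) ∈ E := by
  by_contra! hcon
  have hsub : cutEdges E W ∪ cutEdges E (A \ W) ⊆ cutEdges E A := by
    intro e
    induction e using Sym2.ind with
    | _ x y =>
      simp only [mem_union, mk_mem_cutEdges, mem_sdiff]
      have h1 := hcon x
      have h2 := hcon y
      have h3 := @hWA.1 x
      have h4 := @hWA.1 y
      have h5 : s(y, x) = s(x, y) := Sym2.eq_swap
      grind
  have hdis : Disjoint (cutEdges E W) (cutEdges E (A \ W)) := by
    rw [Finset.disjoint_left]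
    intro e
    induction e using Sym2.ind with
    | _ x y =>
      simp only [mk_mem_cutEdges, mem_sdiff]
      have h1 := hcon x
      have h2 := hcon y
      have h3 := @hWA.1 x
      have h4 := @hWA.1 y
      have h5 : s(y, x) = s(x, y) := Sym2.eq_swap
      grind
  obtain ⟨a, haA, haW⟩ := exists_of_ssubset hWA
  obtain ⟨w, hw⟩ := hW
  have h1 := h.three_le_cut W ⟨w, hw⟩ (fun hu => haW (hu ▸ mem_univ a))
  have h2 := h.three_le_cut (A \ W) ⟨a, mem_sdiff.2 ⟨haA, haW⟩⟩
    (fun hu => (mem_sdiff.1 (hu ▸ mem_univ w : w ∈ A \ W)).2 hw)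
  have h3 := card_le_card hsub
  rw [card_union_of_disjoint hdis] at h3
  omega

theorem eq_const_of_edgeVertexMatrix_mulVec_eq_zero (h : IsSphericalMap E faces) {A : Finset V}
    (hA : #(cutEdges E A) ≤ 3) (z : A → ZMod 2) (hz : edgeVertexMatrix E A *ᵥ z = 0) :
    ∃ c, z = fun _ => c := by
  rcases isEmpty_or_nonempty A with h0 | ⟨⟨a, ha⟩⟩
  · exact ⟨0, funext fun v => h0.elim v⟩
  refine ⟨z ⟨a, ha⟩, ?_⟩
  set W : Finset V := {v | ∃ hv : v ∈ A, z ⟨v, hv⟩ = z ⟨a, ha⟩} with hWdef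
  have hWA : W ⊆ A := fun v hv => (mem_filter.1 hv).2.1
  rcases hWA.eq_or_ssubset with heq | hss
  · funext ⟨v, hv⟩
    rw [← heq] at hv
    exact (mem_filter.1 hv).2.2
  · obtain ⟨x, hx, y, hy, hyW, he⟩ :=
      h.exists_edge_of_ssubset hA ⟨a, mem_filter.2 ⟨mem_univ _, ha, rfl⟩⟩ hss
    refine absurd ?_ hyW
    obtain ⟨hxA, hzx⟩ := (mem_filter.1 hx).2
    have := h.edgeVertexMatrix_mulVec z (mk_mem_edgesIn.2 ⟨he, hxA, hy⟩)
    rw [hz, hzx] at this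
    refine mem_filter.2 ⟨mem_univ _, hy, ?_⟩
    exact (CharTwo.add_eq_zero.1 this.symm).symm

theorem support_of_faceEdgeMatrix_transpose_mulVec_eq_zero (h : IsSphericalMap E faces)
    {A : Finset V} (y : facesIn faces A → ZMod 2) (hy : (faceEdgeMatrix E faces A)ᵀ *ᵥ y = 0) :
    y = 0 ∨ (facesIn faces A = faces ∧ y = fun _ => 1) := by
  set w : Finset (Sym2 V) → ZMod 2 :=
    fun f => if hf : f ∈ facesIn faces A then y ⟨f, hf⟩ else 0 with hw
  have hwy : ∀ f : facesIn faces A, w f = y f := fun f => by simp [hw]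
  have hw1 : ∀ f, w f ≠ 0 → w f = 1 := fun f => by generalize w f = t; revert t; decide
  have hX := h.eq_empty_or_eq_faces (X := {f ∈ faces | w f ≠ 0}) (filter_subset _ _) (by
    intro e he
    rw [← ZMod.natCast_eq_zero_iff_even, card_filter, sum_filter, Nat.cast_sum]
    by_cases heA : e ∈ edgesIn E A
    · have hye := congrFun hy ⟨e, heA⟩
      simp only [Matrix.mulVec, dotProduct, Matrix.transpose_apply, faceEdgeMatrix,
        Matrix.of_apply, Pi.zero_apply, ← hwy] at hye
      rw [sum_coe_sort (facesIn faces A)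
        (fun f => (if e ∈ f then (1 : ZMod 2) else 0) * w f)] at hye
      refine Eq.trans ?_ hye
      symm
      refine (sum_subset (filter_subset _ _) fun f hf hfA => ?_).trans (sum_congr rfl fun f hf => ?_)
      · have : w f = 0 := dif_neg hfA
        simp [this]
      · by_cases h1 : e ∈ f <;> by_cases h2 : w f = 0
        · simp [h1, h2]
        · simp [h1, hw1 f h2]
        · simp [h1, h2]
        · simp [h1, hw1 f h2]
    · refine sum_eq_zero fun f hf => ?_
      by_cases hfA : f ∈ facesIn faces A
      · have hef : e ∉ f := fun hef => heA (mem_filter.2 ⟨he, (mem_filter.1 hfA).2 e hef⟩)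
        simp [hef]
      · have : w f = 0 := dif_neg hfA
        simp [this])
  rcases hX with hX | hX
  · left
    funext f
    by_contra hne
    have : f.1 ∈ ({f ∈ faces | w f ≠ 0} : Finset _) :=
      mem_filter.2 ⟨(mem_filter.1 f.2).1, by rw [hwy]; exact hne⟩
    simp [hX] at this
  · right
    have hne : ∀ f ∈ faces, w f ≠ 0 := fun f hf => by
      rw [← hX] at hf
      exact (mem_filter.1 hf).2
    refine ⟨Subset.antisymm (filter_subset _ _) fun f hf => ?_, funext fun f => ?_⟩
    · by_contra hfA
      exact hne f hf (dif_neg hfA)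
    · rw [← hwy]
      exact hw1 _ (hne _ (mem_filter.1 f.2).1)

theorem card_add_card_facesIn_le (h : IsSphericalMap E faces) {A : Finset V}
    (hA : #(cutEdges E A) = 3) : #A + #(facesIn faces A) ≤ #(edgesIn E A) + 1 := by
  have hle := card_add_card_le (edgeVertexMatrix E A) (faceEdgeMatrix E faces A)
    (h.faceEdgeMatrix_mul_edgeVertexMatrix A)
    (h.eq_const_of_edgeVertexMatrix_mulVec_eq_zero hA.le) (fun y hy => by
      rcases h.support_of_faceEdgeMatrix_transpose_mulVec_eq_zero y hy with h0 | ⟨h0, -⟩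
      · exact h0
      · obtain ⟨e, he⟩ := card_pos.1 (show 0 < #(cutEdges E A) by omega)
        obtain ⟨he, -, v, hv, hvA⟩ := mem_filter.1 he
        obtain ⟨f, hf⟩ := card_pos.1 (show 0 < #{f ∈ faces | e ∈ f} by
          rw [h.card_faces_edge e he]; norm_num)
        obtain ⟨hf, hef⟩ := mem_filter.1 hf
        rw [← h0] at hf
        exact absurd ((mem_filter.1 hf).2 e hef v hv) hvA)
  simpa using hle

theorem exists_cutEdges_eq (h : IsSphericalMap E faces) {D : Finset (Sym2 V)} (hD : D ⊆ E)
    (heven : ∀ f ∈ faces, Even #{e ∈ f | e ∈ D}) : ∃ A, cutEdges E A = D := by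
  have hEuniv : edgesIn E univ = E := by simp [edgesIn]
  have hFuniv : facesIn faces (univ : Finset V) = faces := by simp [facesIn]
  have hcutuniv : #(cutEdges E univ) ≤ 3 := by simp [cutEdges]
  obtain ⟨z, hz⟩ := exists_mulVec_eq_of_mulVec_eq_zero (edgeVertexMatrix E univ)
    (faceEdgeMatrix E faces univ) (h.faceEdgeMatrix_mul_edgeVertexMatrix univ)
    (h.eq_const_of_edgeVertexMatrix_mulVec_eq_zero hcutuniv) (fun y hy => by
      rcases h.support_of_faceEdgeMatrix_transpose_mulVec_eq_zero y hy with h0 | ⟨-, h0⟩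
      · exact ⟨0, h0⟩
      · exact ⟨1, h0⟩)
    (by simpa [hEuniv, hFuniv] using h.euler)
    (fun e => if e.1 ∈ D then 1 else 0) (by
      ext ⟨f, hf⟩
      simp only [Matrix.mulVec, dotProduct, faceEdgeMatrix, Matrix.of_apply, Pi.zero_apply]
      rw [sum_coe_sort (edgesIn E univ)
        (fun e => (if e ∈ f then (1 : ZMod 2) else 0) * if e ∈ D then 1 else 0)]
      have heq : ∀ e ∈ edgesIn E univ,
          ((if e ∈ f then (1 : ZMod 2) else 0) * if e ∈ D then 1 else 0) =
            if e ∈ f ∧ e ∈ D then 1 else 0 := by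
        intro e _
        by_cases h1 : e ∈ f <;> by_cases h2 : e ∈ D <;> simp [h1, h2]
      rw [sum_congr rfl heq, ← sum_filter, sum_const, nsmul_one]
      have hset : {e ∈ edgesIn E univ | e ∈ f ∧ e ∈ D} = {e ∈ f | e ∈ D} := by
        ext e
        have := @hD e
        simp only [hEuniv, mem_filter]
        tauto
      rw [hset]
      exact (ZMod.natCast_eq_zero_iff_even).2 (heven f (mem_filter.1 hf).1))
  refine ⟨univ.filter fun v => z ⟨v, mem_univ v⟩ = 1, ?_⟩
  ext e
  induction e using Sym2.ind with
  | _ x y =>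
    simp only [mk_mem_cutEdges, mem_filter, mem_univ, true_and]
    by_cases he : s(x, y) ∈ E
    · have h1 := h.edgeVertexMatrix_mulVec z (mk_mem_edgesIn.2 ⟨he, mem_univ x, mem_univ y⟩)
      rw [hz] at h1
      have key : ∀ s t r : ZMod 2, r = s + t → (s = 1 ∧ ¬ t = 1 ∨ ¬ s = 1 ∧ t = 1 ↔ r = 1) := by
        decide
      rw [key _ _ _ h1]
      simp [he]
    · exact ⟨fun h1 => absurd h1.1 he, fun h1 => absurd (hD h1) he⟩

theorem three_mul_card (h : IsSphericalMap E faces) {A : Finset V} (hA : #(cutEdges E A) = 3) :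
    3 * #A = 2 * #(edgesIn E A) + 3 := by
  have hs := sum_card_edgesAt h.not_isDiag A
  rw [sum_congr rfl fun v _ => h.card_edgesAt v, sum_const, hA, smul_eq_mul] at hs
  omega

theorem card_add_card_facesIn (h : IsSphericalMap E faces) {A : Finset V}
    (hA : #(cutEdges E A) = 3) : #A + #(facesIn faces A) = #(edgesIn E A) + 1 := by
  have hAc : #(cutEdges E Aᶜ) = 3 := by rw [cutEdges_compl, hA]
  have h1 := h.card_add_card_facesIn_le hA
  have h2 := h.card_add_card_facesIn_le hAc
  have h3 := h.sum_faces A fun _ => 1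
  simp only [sum_const, smul_eq_mul, mul_one, h.card_facesCrossing hA] at h3
  have h4 := card_edgesIn_add_card_edgesIn_compl_add_card_cutEdges E A
  have h5 := h.euler
  have h6 := card_add_card_compl A
  omega

theorem card_pentagonsIn (h : IsSphericalMap E faces) {A : Finset V}
    (hA : #(cutEdges E A) = 3) : #(pentagonsIn faces A) = boundaryLength faces A := by
  have h1 := h.card_add_card_facesIn hA
  have h2 := h.three_mul_card hA
  have h3 := h.sum_card_facesIn_add_boundaryLength A
  have h4 := h.sum_card_facesIn_add_pentagonsIn A
  omega

/-- The vertices of `A` on faces crossing the boundary of `A`. -/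
def boundaryVerts (faces : Finset (Finset (Sym2 V))) (A : Finset V) : Finset V :=
  {v ∈ A | ∃ f ∈ facesCrossing faces A, (edgesAt f v).Nonempty}

/-- The ends in `A` of the cut edges. -/
def cutVerts (E : Finset (Sym2 V)) (A : Finset V) : Finset V :=
  {v ∈ A | (edgesAt (cutEdges E A) v).Nonempty}

theorem mem_boundaryVerts_of_mem {f : Finset (Sym2 V)} {A : Finset V} {e : Sym2 V} {v : V}
    (hv : v ∈ A) (hf : f ∈ facesCrossing faces A) (he : e ∈ f) (hve : v ∈ e) :
    v ∈ boundaryVerts faces A :=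
  mem_filter.2 ⟨hv, f, hf, e, mem_filter.2 ⟨he, hve⟩⟩

theorem mem_facesCrossing_of_mem {f : Finset (Sym2 V)} {A : Finset V} {e : Sym2 V}
    (hf : f ∈ faces) (hef : e ∈ f) (he : e ∈ cutEdges E A) : f ∈ facesCrossing faces A :=
  mem_filter.2 ⟨hf, e, mem_filter.2 ⟨hef, (mem_filter.1 he).2⟩⟩

theorem exists_face (h : IsSphericalMap E faces) {e : Sym2 V} (he : e ∈ E) :
    ∃ f ∈ faces, e ∈ f := by
  obtain ⟨f, hf⟩ := card_pos.1 (show 0 < #{f ∈ faces | e ∈ f} by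
    rw [h.card_faces_edge e he]; norm_num)
  exact ⟨f, mem_filter.1 hf⟩

theorem cutVerts_subset_boundaryVerts (h : IsSphericalMap E faces) (A : Finset V) :
    cutVerts E A ⊆ boundaryVerts faces A := by
  intro v hv
  obtain ⟨hvA, e, he⟩ := mem_filter.1 hv
  obtain ⟨he, hve⟩ := mem_filter.1 he
  obtain ⟨f, hf, hef⟩ := h.exists_face (mem_filter.1 he).1
  exact mem_boundaryVerts_of_mem hvA (mem_facesCrossing_of_mem hf hef he) hef hve

theorem card_edgesAt_cutEdges_le_one (h : IsSphericalMap E faces) {A : Finset V}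
    (hA : #(cutEdges E A) = 3) (hA2 : 2 ≤ #A) {v : V} (hv : v ∈ A) :
    #(edgesAt (cutEdges E A) v) ≤ 1 := by
  by_contra! hlt
  have hsub : cutEdges E (A.erase v) ⊆ (cutEdges E A \ edgesAt (cutEdges E A) v) ∪
      (edgesAt E v \ edgesAt (cutEdges E A) v) := by
    intro e
    induction e using Sym2.ind with
    | _ x y =>
      simp only [mem_union, mem_sdiff, edgesAt, mem_filter, mk_mem_cutEdges, mem_erase,
        Sym2.mem_iff]
      grind
  have h1 := (card_le_card hsub).trans (card_union_le _ _)
  have hatcut : edgesAt (cutEdges E A) v ⊆ cutEdges E A := filter_subset _ _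
  rw [card_sdiff_of_subset hatcut, card_sdiff_of_subset (edgesAt_mono (cutEdges_subset E A) v), h.card_edgesAt,
    hA] at h1
  have h2 := h.three_le_cut (A.erase v)
    (card_pos.1 (by rw [card_erase_of_mem hv]; omega))
    (fun hu => notMem_erase v A (hu ▸ mem_univ v))
  omega

theorem card_cutVerts (h : IsSphericalMap E faces) {A : Finset V}
    (hA : #(cutEdges E A) = 3) (hA2 : 2 ≤ #A) : #(cutVerts E A) = 3 := by
  rw [cutVerts, card_filter, ← hA, ← sum_card_edgesAt_cutEdges h.not_isDiag A]
  refine sum_congr rfl fun v hv => ?_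
  have h3 := h.card_edgesAt_cutEdges_le_one hA hA2 hv
  split_ifs with h0
  · have := card_pos.2 h0
    omega
  · rw [not_nonempty_iff_eq_empty.1 h0, card_empty]

theorem card_verts_face (h : IsSphericalMap E faces) {A : Finset V}
    {f : Finset (Sym2 V)} (hf : f ∈ faces) :
    2 * #{v ∈ A | (edgesAt f v).Nonempty} = 2 * #(edgesIn f A) + #(cutEdges f A) := by
  rw [← sum_card_edgesAt (fun e he => h.not_isDiag e (h.face_subset f hf he)) A, card_filter,
    mul_sum]
  refine sum_congr rfl fun v _ => ?_
  split_ifs with h0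
  · rw [h.card_edgesAt_face f hf v h0, mul_one]
  · rw [not_nonempty_iff_eq_empty.1 h0, card_empty, mul_zero]

theorem card_boundaryVerts_le (h : IsSphericalMap E faces) {A : Finset V}
    (hA : #(cutEdges E A) = 3) (hA2 : 2 ≤ #A) :
    #(boundaryVerts faces A) ≤ boundaryLength faces A := by
  have hd := sum_card_bipartiteAbove_eq_sum_card_bipartiteBelow (s := A)
    (t := facesCrossing faces A) (fun v f => (edgesAt f v).Nonempty)
  simp only [bipartiteAbove, bipartiteBelow] at hd
  have hr : ∑ f ∈ facesCrossing faces A, #{v ∈ A | (edgesAt f v).Nonempty} =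
      boundaryLength faces A + 3 := by
    rw [sum_congr rfl (g := fun f => #(edgesIn f A) + 1), sum_add_distrib, sum_const,
      h.card_facesCrossing hA]
    · rfl
    · intro f hf
      have h1 := h.card_verts_face (A := A) (mem_filter.1 hf).1
      rw [h.card_cutEdges_of_crossing hA hf] at h1
      omega
  have hl : #(boundaryVerts faces A) + #(cutVerts E A) ≤
      ∑ v ∈ A, #{f ∈ facesCrossing faces A | (edgesAt f v).Nonempty} := by
    rw [boundaryVerts, cutVerts, card_filter, card_filter, ← sum_add_distrib]
    refine sum_le_sum fun v hv => ?_
    by_cases h2 : (edgesAt (cutEdges E A) v).Nonempty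
    · obtain ⟨e, he⟩ := h2
      obtain ⟨he, hve⟩ := mem_filter.1 he
      have hsub : {f ∈ faces | e ∈ f} ⊆
          {f ∈ facesCrossing faces A | (edgesAt f v).Nonempty} := by
        intro f hf
        obtain ⟨hf, hef⟩ := mem_filter.1 hf
        exact mem_filter.2 ⟨mem_facesCrossing_of_mem hf hef he, e, mem_filter.2 ⟨hef, hve⟩⟩
      have h3 := card_le_card hsub
      rw [h.card_faces_edge e (mem_filter.1 he).1] at h3
      refine le_trans ?_ h3
      split_ifs <;> norm_num
    · rw [if_neg h2, add_zero]
      split_ifs with h1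
      · obtain ⟨f, hf, hfv⟩ := h1
        exact card_pos.2 ⟨f, mem_filter.2 ⟨hf, hfv⟩⟩
      · exact Nat.zero_le _
  rw [hd, hr, h.card_cutVerts hA hA2] at hl
  omega

theorem card_cutEdges_sdiff_le (h : IsSphericalMap E faces) {A : Finset V}
    (hA : #(cutEdges E A) = 3) (hA2 : 2 ≤ #A) :
    #(cutEdges E (A \ boundaryVerts faces A)) + 3 ≤ #(boundaryVerts faces A) := by
  set S := boundaryVerts faces A with hS
  have hinner : ∀ f ∈ facesCrossing faces A, ∀ e ∈ f, e ∉ cutEdges E (A \ S) := by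
    intro f hf e hef he
    obtain ⟨-, ⟨x, hx, hxA⟩, -⟩ := mem_filter.1 he
    obtain ⟨hxA, hxS⟩ := mem_sdiff.1 hxA
    exact hxS (mem_boundaryVerts_of_mem hxA hf hef hx)
  have hsub : cutEdges E (A \ S) ⊆
      (S \ cutVerts E A).biUnion fun v => edgesAt (cutEdges E (A \ S)) v := by
    intro e he
    obtain ⟨heE, ⟨x, hx, hxA⟩, y, hy, hyA⟩ := mem_filter.1 he
    have hyA' : y ∈ A := by
      by_contra hy'
      have hcut : e ∈ cutEdges E A :=
        mem_filter.2 ⟨heE, ⟨x, hx, (mem_sdiff.1 hxA).1⟩, y, hy, hy'⟩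
      obtain ⟨f, hf, hef⟩ := h.exists_face heE
      exact hinner f (mem_facesCrossing_of_mem hf hef hcut) e hef he
    have hyS : y ∈ S := by
      by_contra hy'
      exact hyA (mem_sdiff.2 ⟨hyA', hy'⟩)
    refine mem_biUnion.2 ⟨y, mem_sdiff.2 ⟨hyS, fun hyT => ?_⟩, mem_filter.2 ⟨he, hy⟩⟩
    obtain ⟨-, d, hd⟩ := mem_filter.1 hyT
    obtain ⟨hd, hyd⟩ := mem_filter.1 hd
    obtain ⟨f, hf, hdf, hef⟩ := h.exists_common_face (v := y)
      (mem_filter.2 ⟨(mem_filter.1 hd).1, hyd⟩) (mem_filter.2 ⟨heE, hy⟩)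
    exact hinner f (mem_facesCrossing_of_mem hf hdf hd) e hef he
  have hle := (card_le_card hsub).trans (card_biUnion_le_card_mul _ _ 1 fun v hv => by
    obtain ⟨-, f, hf, hfv⟩ := mem_filter.1 (mem_sdiff.1 hv).1
    have hdis : Disjoint (edgesAt f v) (edgesAt (cutEdges E (A \ S)) v) := by
      rw [Finset.disjoint_left]
      intro e he he'
      exact hinner f hf e (mem_filter.1 he).1 (mem_filter.1 he').1
    have h1 := card_le_card (union_subset (h.edgesAt_face_subset (mem_filter.1 hf).1 v)
      (edgesAt_mono (cutEdges_subset E (A \ S)) v))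
    rw [card_union_of_disjoint hdis, h.card_edgesAt,
      h.card_edgesAt_face f (mem_filter.1 hf).1 v hfv] at h1
    omega)
  rw [card_sdiff_of_subset (h.cutVerts_subset_boundaryVerts A), h.card_cutVerts hA hA2] at hle
  have h3 := card_le_card (h.cutVerts_subset_boundaryVerts A)
  rw [h.card_cutVerts hA hA2] at h3
  rw [← hS] at h3 hle
  omega

theorem six_lt_boundaryLength (h : IsSphericalMap E faces) (A : Finset V)
    (hA : #(cutEdges E A) = 3) (hA2 : 2 ≤ #A) : 6 < boundaryLength faces A := by
  induction A using Finset.strongInduction with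
  | _ A ih =>
  by_contra! hl
  set S := boundaryVerts faces A with hS
  have hSA : S ⊆ A := filter_subset _ _
  have h1 := h.card_cutEdges_sdiff_le hA hA2
  have h2 := h.card_boundaryVerts_le hA hA2
  rw [← hS] at h1 h2
  have h3 := h.card_pentagonsIn hA
  have h4 := h.card_add_card_facesIn hA
  have h5 := h.three_mul_card hA
  have h6 : #(pentagonsIn faces A) ≤ #(facesIn faces A) := card_filter_le _ _
  have h7 := card_sdiff_of_subset hSA
  have h8 := card_le_card hSA
  have hlt : A \ S ⊂ A := sdiff_ssubset hSA (card_pos.1 (by omega))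
  have h9 := h.three_le_cut (A \ S) (card_pos.1 (by omega))
    (fun hu => hlt.2 (hu ▸ subset_univ A))
  have hA' : #(cutEdges E (A \ S)) = 3 := by omega
  have h10 := ih _ hlt hA' (by omega)
  rw [← h.card_pentagonsIn hA'] at h10
  have h11 : pentagonsIn faces (A \ S) ⊆ pentagonsIn faces A := by
    intro f hf
    obtain ⟨hf, hf5⟩ := mem_filter.1 hf
    obtain ⟨hf, hfA⟩ := mem_filter.1 hf
    exact mem_filter.2 ⟨mem_filter.2 ⟨hf, fun e he v hv => hlt.1 (hfA e he v hv)⟩, hf5⟩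
  have h12 := card_le_card h11
  omega

theorem card_le_one_or_of_card_cutEdges (h : IsSphericalMap E faces) {A : Finset V}
    (hA : #(cutEdges E A) = 3) : #A ≤ 1 ∨ #Aᶜ ≤ 1 := by
  by_contra! hcon
  have h1 := h.six_lt_boundaryLength A hA hcon.1
  have h2 := h.six_lt_boundaryLength Aᶜ (by rw [cutEdges_compl, hA]) hcon.2
  have h3 := h.boundaryLength_add_compl_le hA
  omega

theorem not_four_cycle_subset_face (h : IsSphericalMap E faces) {f : Finset (Sym2 V)}
    (hf : f ∈ faces) {v a x b : V} (hab : a ≠ b) (hvx : v ≠ x) (hva : s(v, a) ∈ f)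
    (hvb : s(v, b) ∈ f) (hax : s(a, x) ∈ f) (hbx : s(b, x) ∈ f) : False := by
  have hne : ∀ y z, s(y, z) ∈ f → y ≠ z := fun y z hyz hEq =>
    h.not_isDiag _ (h.face_subset f hf hyz) (by simpa using hEq)
  have h1 := hne _ _ hva
  have h2 := hne _ _ hvb
  have h3 := hne _ _ hax
  have h4 := hne _ _ hbx
  set W : Finset V := {v, a, x, b} with hW
  have hcW : #W ≤ 4 := card_le_four
  have hcard := h.card_verts_face (A := W) hf
  have hle : #{u ∈ W | (edgesAt f u).Nonempty} ≤ #W := card_filter_le _ _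
  have hsub : ({s(v, a), s(v, b), s(a, x), s(b, x)} : Finset (Sym2 V)) ⊆ edgesIn f W := by
    intro e he
    simp only [mem_insert, mem_singleton] at he
    rcases he with rfl | rfl | rfl | rfl <;> simp [mk_mem_edgesIn, *]
  have h4' : #({s(v, a), s(v, b), s(a, x), s(b, x)} : Finset (Sym2 V)) = 4 := by
    rw [card_insert_of_notMem, card_insert_of_notMem, card_insert_of_notMem, card_singleton] <;>
      simp <;> grind
  have h5 := card_le_card hsub
  have hcut : cutEdges f W = ∅ := card_eq_zero.1 (by omega)
  rcases h.face_connected f hf W hcut with h6 | h6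
  · have h7 : edgesIn f W = f := filter_true_of_mem h6
    rw [h7] at hcard
    rcases h.card_face f hf with h8 | h8 <;> omega
  · exact h6 _ hva v (Sym2.mem_mk_left _ _) (by simp [hW])

theorem mem_iff_of_two_faces (h : IsSphericalMap E faces) {e : Sym2 V} {f g : Finset (Sym2 V)}
    (hf : f ∈ faces) (hg : g ∈ faces) (hfg : f ≠ g) (hef : e ∈ f) (heg : e ∈ g) :
    ∀ k ∈ faces, e ∈ k ↔ k = f ∨ k = g := by
  have hsub : {f, g} ⊆ {k ∈ faces | e ∈ k} := by
    intro k hk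
    rcases mem_insert.1 hk with rfl | hk
    · exact mem_filter.2 ⟨hf, hef⟩
    · rw [mem_singleton.1 hk]
      exact mem_filter.2 ⟨hg, heg⟩
  have heq := eq_of_subset_of_card_le hsub
    (by rw [h.card_faces_edge e (h.face_subset f hf hef), card_pair hfg])
  intro k hk
  have : k ∈ ({f, g} : Finset _) ↔ k ∈ {k ∈ faces | e ∈ k} := by rw [heq]
  simpa [hk] using this.symm

theorem eq_edgesAt_of_card_le_one (h : IsSphericalMap E faces) {A : Finset V}
    (hA : #(cutEdges E A) = 3) (hA1 : #A ≤ 1) : ∃ x, cutEdges E A = edgesAt E x := by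
  have hne : A.Nonempty := by
    obtain ⟨e, he⟩ := card_pos.1 (show 0 < #(cutEdges E A) by omega)
    obtain ⟨-, ⟨v, -, hv⟩, -⟩ := mem_filter.1 he
    exact ⟨v, hv⟩
  obtain ⟨x, rfl⟩ := card_eq_one.1 (le_antisymm hA1 (card_pos.2 hne))
  refine ⟨x, eq_of_subset_of_card_le (fun e he => ?_) (by rw [h.card_edgesAt, hA])⟩
  obtain ⟨he, ⟨v, hv, hvx⟩, -⟩ := mem_filter.1 he
  rw [mem_singleton] at hvx
  exact mem_filter.2 ⟨he, hvx ▸ hv⟩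

/-- Two distinct faces opposite to a common vertex `v` (each through a neighbour of `v`, but not
through the edge joining that neighbour to `v`) are disjoint. -/
theorem opposite_faces_disjoint (h : IsSphericalMap E faces) {v a b w : V} (hab : a ≠ b)
    (hva : s(v, a) ∈ E) (hvb : s(v, b) ∈ E) {f g : Finset (Sym2 V)} (hfg : f ≠ g)
    (hf : f ∈ facesAt faces a) (hg : g ∈ facesAt faces b) (hfa : s(v, a) ∉ f)
    (hgb : s(v, b) ∉ g) (hfw : f ∈ facesAt faces w) (hgw : g ∈ facesAt faces w) : False := by
  obtain ⟨k, hk, hka, hkb⟩ := h.exists_common_face (v := v)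
    (mem_filter.2 ⟨hva, Sym2.mem_mk_left _ _⟩) (mem_filter.2 ⟨hvb, Sym2.mem_mk_left _ _⟩)
  have hkf : k ≠ f := fun hEq => hfa (hEq ▸ hka)
  have hkg : k ≠ g := fun hEq => hgb (hEq ▸ hkb)
  obtain ⟨d₁, hd₁k, hd₁f, had₁⟩ := h.exists_common_edge
    (faces_subset_facesAt (Sym2.mem_mk_right v a) (mem_filter.2 ⟨hk, hka⟩)) hf
  obtain ⟨d₂, hd₂k, hd₂g, hbd₂⟩ := h.exists_common_edge
    (faces_subset_facesAt (Sym2.mem_mk_right v b) (mem_filter.2 ⟨hk, hkb⟩)) hg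
  obtain ⟨d₃, hd₃f, hd₃g, -⟩ := h.exists_common_edge hfw hgw
  have hf := (mem_filter.1 hf).1
  have hg := (mem_filter.1 hg).1
  have hm₁ := h.mem_iff_of_two_faces hk hf hkf hd₁k hd₁f
  have hm₂ := h.mem_iff_of_two_faces hk hg hkg hd₂k hd₂g
  have hm₃ := h.mem_iff_of_two_faces hf hg hfg hd₃f hd₃g
  have h₁₂ : d₁ ≠ d₂ := by
    rintro rfl
    rcases (hm₁ g hg).1 hd₂g with h0 | h0
    · exact hkg h0.symm
    · exact hfg h0.symm
  have h₁₃ : d₁ ≠ d₃ := by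
    rintro rfl
    rcases (hm₁ g hg).1 hd₃g with h0 | h0
    · exact hkg h0.symm
    · exact hfg h0.symm
  have h₂₃ : d₂ ≠ d₃ := by
    rintro rfl
    rcases (hm₂ f hf).1 hd₃f with h0 | h0
    · exact hkf h0.symm
    · exact hfg h0
  have hD : #({d₁, d₂, d₃} : Finset (Sym2 V)) = 3 := by
    rw [card_insert_of_notMem (by simp [h₁₂, h₁₃]), card_pair h₂₃]
  obtain ⟨A, hA⟩ := h.exists_cutEdges_eq (D := {d₁, d₂, d₃}) (by
    intro e he
    simp only [mem_insert, mem_singleton] at he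
    rcases he with rfl | rfl | rfl
    · exact h.face_subset k hk hd₁k
    · exact h.face_subset k hk hd₂k
    · exact h.face_subset f hf hd₃f) (by
    intro m hm
    have heq : {e ∈ m | e ∈ ({d₁, d₂, d₃} : Finset (Sym2 V))} =
        ({d₁, d₂, d₃} : Finset (Sym2 V)).filter (· ∈ m) := by
      ext e
      simp only [mem_filter]
      tauto
    rw [heq, filter_insert, filter_insert, filter_singleton]
    simp only [hm₁ m hm, hm₂ m hm, hm₃ m hm]
    by_cases h1 : m = k
    · subst h1
      simp [hkf, hkg, h₁₂]
    by_cases h2 : m = f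
    · subst h2
      simp [hkf.symm, hfg, h₁₃]
    by_cases h3 : m = g
    · subst h3
      simp [hkg.symm, hfg.symm, h₂₃]
    simp [h1, h2, h3])
  have hA3 : #(cutEdges E A) = 3 := by rw [hA, hD]
  obtain ⟨x, hx⟩ : ∃ x, cutEdges E A = edgesAt E x := by
    rcases h.card_le_one_or_of_card_cutEdges hA3 with h1 | h1
    · exact h.eq_edgesAt_of_card_le_one hA3 h1
    · rw [← cutEdges_compl]
      exact h.eq_edgesAt_of_card_le_one (by rw [cutEdges_compl, hA3]) h1
  rw [hA] at hx
  have hx₁ : x ∈ d₁ := (mem_filter.1 (hx ▸ (by simp) : d₁ ∈ edgesAt E x)).2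
  have hx₂ : x ∈ d₂ := (mem_filter.1 (hx ▸ (by simp) : d₂ ∈ edgesAt E x)).2
  have hva' : v ≠ a := fun hEq => h.not_isDiag _ hva (by simpa using hEq)
  have hvb' : v ≠ b := fun hEq => h.not_isDiag _ hvb (by simpa using hEq)
  have hxa : a ≠ x := by
    rintro rfl
    have hmem : s(v, a) ∈ edgesAt E a := mem_filter.2 ⟨hva, Sym2.mem_mk_right _ _⟩
    rw [← hx] at hmem
    simp only [mem_insert, mem_singleton] at hmem
    rcases hmem with rfl | rfl | rfl
    · exact hfa hd₁f
    · rcases Sym2.mem_iff.1 hbd₂ with h0 | h0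
      · exact hvb' h0.symm
      · exact hab h0.symm
    · exact hfa hd₃f
  have hxb : b ≠ x := by
    rintro rfl
    have hmem : s(v, b) ∈ edgesAt E b := mem_filter.2 ⟨hvb, Sym2.mem_mk_right _ _⟩
    rw [← hx] at hmem
    simp only [mem_insert, mem_singleton] at hmem
    rcases hmem with rfl | rfl | rfl
    · rcases Sym2.mem_iff.1 had₁ with h0 | h0
      · exact hva' h0.symm
      · exact hab h0
    · exact hgb hd₂g
    · exact hgb hd₃g
  obtain rfl := (Sym2.mem_and_mem_iff hxa).1 ⟨had₁, hx₁⟩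
  obtain rfl := (Sym2.mem_and_mem_iff hxb).1 ⟨hbd₂, hx₂⟩
  refine h.not_four_cycle_subset_face hk hab ?_ hka hkb hd₁k hd₂k
  rintro rfl
  exact hfa (Sym2.eq_swap ▸ hd₁f)

end IsSphericalMap

theorem forall_mem_edges_of_start_mem {G : SimpleGraph V} {A : Finset V} {x y : V}
    (p : G.Walk x y) (hp : cutEdges p.edges.toFinset A = ∅) :
    (x ∈ A → ∀ e ∈ p.edges, ∀ v ∈ e, v ∈ A) ∧ (x ∉ A → ∀ e ∈ p.edges, ∀ v ∈ e, v ∉ A) := by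
  induction p with
  | nil => simp
  | @cons x y z hxy p ih =>
    have hcut : cutEdges p.edges.toFinset A = ∅ := by
      refine filter_false_of_mem fun e he hc => ?_
      have : e ∈ cutEdges (Walk.cons hxy p).edges.toFinset A :=
        mem_filter.2 ⟨by simp at he; simp [he], hc⟩
      rw [hp] at this
      exact notMem_empty _ this
    have hiff : x ∈ A ↔ y ∈ A := by
      by_contra hne
      have : s(x, y) ∈ cutEdges (Walk.cons hxy p).edges.toFinset A :=
        mk_mem_cutEdges.2 ⟨by simp, by tauto⟩
      rw [hp] at this
      exact notMem_empty _ this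
    obtain ⟨h1, h2⟩ := ih hcut
    constructor
    · intro hx e he v hv
      rw [Walk.edges_cons, List.mem_cons] at he
      rcases he with rfl | he
      · rcases Sym2.mem_iff.1 hv with rfl | rfl
        · exact hx
        · exact hiff.1 hx
      · exact h1 (hiff.1 hx) e he v hv
    · intro hx e he v hv
      rw [Walk.edges_cons, List.mem_cons] at he
      rcases he with rfl | he
      · rcases Sym2.mem_iff.1 hv with rfl | rfl
        · exact hx
        · exact fun hy => hx (hiff.2 hy)
      · exact h2 (fun hy => hx (hiff.2 hy)) e he v hv

theorem card_edgesIn_le_choose {X : Finset (Sym2 V)} (hX : ∀ e ∈ X, ¬ e.IsDiag) (A : Finset V) :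
    #(edgesIn X A) ≤ (#A).choose 2 := by
  rw [← Sym2.card_image_offDiag]
  refine card_le_card fun e he => ?_
  induction e using Sym2.ind with
  | _ x y =>
    obtain ⟨he, hx, hy⟩ := mk_mem_edgesIn.1 he
    have hxy : x ≠ y := fun h => hX _ he (by simpa using h)
    exact mem_image.2 ⟨(x, y), mem_offDiag.2 ⟨hx, hy, hxy⟩, rfl⟩

theorem three_le_card_cutEdges {G : SimpleGraph V} {E : Finset (Sym2 V)}
    (hE : ∀ e, e ∈ E ↔ e ∈ G.edgeSet) (hdeg : ∀ v, #(edgesAt E v) = 3)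
    (hconn : ∀ s : Set V, s.ncard ≤ 2 → (G.induce sᶜ).Connected) {A : Finset V}
    (hA : A.Nonempty) (hA' : A ≠ univ) : 3 ≤ #(cutEdges E A) := by
  by_contra! hlt
  have hdiag : ∀ e ∈ E, ¬ e.IsDiag := fun e he => G.not_isDiag_of_mem_edgeSet ((hE e).1 he)
  set s : Finset V := {v ∈ A | (edgesAt (cutEdges E A) v).Nonempty} with hs
  have hs2 : #s ≤ #(cutEdges E A) := by
    rw [← sum_card_edgesAt_cutEdges hdiag A, hs, card_filter]
    refine sum_le_sum fun v _ => ?_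
    split_ifs with h0
    · exact card_pos.2 h0
    · exact Nat.zero_le _
  have hsA : s ⊆ A := filter_subset _ _
  have hss : s ⊂ A := by
    refine hsA.ssubset_of_ne fun heq => ?_
    have h1 := sum_card_edgesAt hdiag A
    rw [sum_congr rfl fun v _ => hdeg v, sum_const, smul_eq_mul] at h1
    have h2 := card_edgesIn_le_choose hdiag A
    have h3 := card_pos.2 hA
    rw [heq] at hs2
    obtain h4 | h4 : #A = 1 ∨ #A = 2 := by omega
    all_goals
      rw [h4] at h1 h2
      norm_num only [Nat.choose] at h2
      omega
  obtain ⟨a, haA, has⟩ := exists_of_ssubset hss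
  obtain ⟨b, hb⟩ : ∃ b, b ∉ A := by
    by_contra! hall
    exact hA' (eq_univ_iff_forall.2 hall)
  have hpre := (hconn (s : Set V) (by rw [Set.ncard_coe_finset]; omega)).preconnected
    ⟨a, by simpa using has⟩ ⟨b, by simpa using fun h => hb (hsA h)⟩
  obtain ⟨p⟩ := hpre
  have hstep : ∀ (x y : ((s : Set V)ᶜ : Set V)) (_ : (G.induce (s : Set V)ᶜ).Walk x y),
      x.1 ∈ A → y.1 ∈ A := by
    intro x y p
    induction p with
    | nil => exact id
    | @cons x y z hxy p ih =>
      intro hx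
      refine ih ?_
      by_contra hy
      have hadj : G.Adj x.1 y.1 := hxy
      have hcut : s(x.1, y.1) ∈ cutEdges E A :=
        mk_mem_cutEdges.2 ⟨(hE _).2 hadj, Or.inl ⟨hx, hy⟩⟩
      exact x.2 (mem_coe.2 (mem_filter.2
        ⟨hx, _, mem_filter.2 ⟨hcut, Sym2.mem_mk_left _ _⟩⟩))
  exact hb (hstep _ _ p haA)

theorem isSphericalMap_of_isFullerene {G : SimpleGraph V} {faces : Finset (Finset (Sym2 V))}
    (hF : IsFullerene G faces) {E : Finset (Sym2 V)} (hE : ∀ e, e ∈ E ↔ e ∈ G.edgeSet) :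
    IsSphericalMap E faces where
  not_isDiag e he := G.not_isDiag_of_mem_edgeSet ((hE e).1 he)
  card_edgesAt v := by
    rw [card_edgesAt_eq_ncard (N := G.neighborSet v), hF.cubic]
    simp [hE]
  three_le_cut A := by
    refine three_le_card_cutEdges hE (fun v => ?_) hF.threeConnected
    rw [card_edgesAt_eq_ncard (N := G.neighborSet v), hF.cubic]
    simp [hE]
  face_subset f hf e he := by
    obtain ⟨v, c, -, rfl⟩ := hF.face_cycle f hf
    exact (hE e).2 (c.edges_subset_edgeSet (List.mem_toFinset.1 he))
  card_edgesAt_face f hf v hv := by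
    obtain ⟨u, c, hc, rfl⟩ := hF.face_cycle f hf
    rw [card_edgesAt_eq_ncard (N := c.toSubgraph.neighborSet v),
      hc.ncard_neighborSet_toSubgraph_eq_two]
    · obtain ⟨e, he⟩ := hv
      obtain ⟨he, hve⟩ := mem_filter.1 he
      exact c.mem_support_of_mem_edges (List.mem_toFinset.1 he) hve
    · intro w
      rw [List.mem_toFinset, ← c.mem_edges_toSubgraph]
      rfl
  face_connected f hf A hA := by
    obtain ⟨u, c, -, rfl⟩ := hF.face_cycle f hf
    obtain ⟨h1, h2⟩ := forall_mem_edges_of_start_mem c hA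
    simp only [List.mem_toFinset]
    by_cases hu : u ∈ A
    · exact Or.inl (h1 hu)
    · exact Or.inr (h2 hu)
  card_face := hF.face_size
  card_faces_edge e he := hF.edge_two_faces e ((hE e).1 he)
  euler := by
    have hcard : G.edgeSet.ncard = #E := by
      rw [← Set.ncard_coe_finset]
      congr 1
      ext e
      simp [hE]
    rw [hF.euler, hcard]

/-- In a 3-resonant fullerene every vertex is joined to a pentagon by an edge
not on that pentagon. -/
theorem exists_adj_pentagon {G : SimpleGraph V} {faces : Finset (Finset (Sym2 V))}
    (hF : IsFullerene G faces) (hres : KResonant G faces 3) {E : Finset (Sym2 V)}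
    (hE : ∀ e, e ∈ E ↔ e ∈ G.edgeSet) (v : V) :
    ∃ u, s(u, v) ∈ E ∧ ∃ f ∈ facesAt faces u, #f = 5 ∧ s(u, v) ∉ f := by
  have hmap := isSphericalMap_of_isFullerene hF hE
  by_contra! hcon
  have hopp : ∀ u, G.Adj v u → ∃ f ∈ facesAt faces u, s(v, u) ∉ f := fun u hu =>
    hmap.exists_face_avoiding (mem_filter.2 ⟨(hE _).2 hu, Sym2.mem_mk_right v u⟩)
  choose! F hFat hFv using hopp
  have hfin : (G.neighborSet v).Finite := Set.toFinite _
  obtain ⟨M, hM, halt⟩ := hres (hfin.toFinset.image F)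
    (fun f hf => by
      obtain ⟨u, hu, rfl⟩ := mem_image.1 hf
      exact (mem_filter.1 (hFat u (by simpa using hu))).1)
    (fun f hf => by
      obtain ⟨u, hu, rfl⟩ := mem_image.1 hf
      have hadj : G.Adj v u := by simpa using hu
      refine (hF.face_size _ (mem_filter.1 (hFat u hadj)).1).resolve_left fun h5 => ?_
      have h1 := hFv u hadj
      rw [Sym2.eq_swap] at h1
      exact h1 (hcon u ((hE _).2 hadj.symm) _ (hFat u hadj) h5))
    (fun f hf g hg hfg => by
      obtain ⟨a, ha, rfl⟩ := mem_image.1 hf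
      obtain ⟨b, hb, rfl⟩ := mem_image.1 hg
      have hadja : G.Adj v a := by simpa using ha
      have hadjb : G.Adj v b := by simpa using hb
      rw [Set.disjoint_left]
      intro w hwa hwb
      rw [mem_faceVerts_iff] at hwa hwb
      exact hmap.opposite_faces_disjoint (fun hab => hfg (congrArg F hab)) ((hE _).2 hadja)
        ((hE _).2 hadjb) hfg (hFat a hadja) (hFat b hadjb) (hFv a hadja) (hFv b hadjb)
        (mem_filter.2 ⟨(mem_filter.1 (hFat a hadja)).1, hwa⟩)
        (mem_filter.2 ⟨(mem_filter.1 (hFat b hadjb)).1, hwb⟩))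
    (card_image_le.trans (by rw [← Set.ncard_eq_toFinset_card _ hfin, hF.cubic]))
  rw [Subgraph.isPerfectMatching_iff] at hM
  obtain ⟨u, hu, -⟩ := hM v
  have hadj : G.Adj v u := hu.adj_sub
  obtain ⟨w, hwf, hw⟩ := halt (F u) (mem_image_of_mem F (by simpa using hadj)) u
    (mem_faceVerts_iff.2 (mem_filter.1 (hFat u hadj)).2)
  obtain rfl : w = v := (hM u).unique hw hu.symm
  rw [Sym2.eq_swap] at hwf
  exact hFv u hadj hwf

theorem card_le_sixty {E : Finset (Sym2 V)} {faces : Finset (Finset (Sym2 V))}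
    (h : IsSphericalMap E faces) (hpent : #{f ∈ faces | #f = 5} = 12)
    (hadj : ∀ v, ∃ u, s(u, v) ∈ E ∧ ∃ f ∈ facesAt faces u, #f = 5 ∧ s(u, v) ∉ f) :
    Fintype.card V ≤ 60 := by
  have hcover : (univ : Finset V) ⊆ ({f ∈ faces | #f = 5} : Finset _).biUnion fun f =>
      ({u | (edgesAt f u).Nonempty} : Finset V).biUnion fun u =>
        {v | s(u, v) ∈ E ∧ s(u, v) ∉ f} := by
    intro v _
    obtain ⟨u, hu, f, hf, hf5, huf⟩ := hadj v
    obtain ⟨hf, hfu⟩ := mem_filter.1 hf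
    simp only [mem_biUnion, mem_filter, mem_univ, true_and]
    exact ⟨f, ⟨hf, hf5⟩, u, hfu, hu, huf⟩
  refine (card_le_card hcover).trans ((card_biUnion_le_card_mul _ _ 5 fun f hf => ?_).trans
    (by rw [hpent]))
  obtain ⟨hf, hf5⟩ := mem_filter.1 hf
  have hverts : #({u | (edgesAt f u).Nonempty} : Finset V) = 5 := by
    have h1 := h.card_verts_face (A := univ) hf
    have h2 : edgesIn f univ = f := by simp [edgesIn]
    have h3 : cutEdges f univ = ∅ := by simp [cutEdges]
    rw [h2, h3, hf5, card_empty] at h1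
    omega
  refine (card_biUnion_le_card_mul _ _ 1 fun u hu => ?_).trans (by rw [hverts])
  have hfu := (mem_filter.1 hu).2
  have h1 : #({v | s(u, v) ∈ E ∧ s(u, v) ∉ f} : Finset V) ≤ #(edgesAt E u \ edgesAt f u) := by
    refine card_le_card_of_injOn (fun v => s(u, v)) (fun v hv => ?_)
      (fun a _ b _ hab => Sym2.congr_right.1 hab)
    have hv' := (mem_filter.1 hv).2
    exact mem_sdiff.2 ⟨mem_filter.2 ⟨hv'.1, Sym2.mem_mk_left u v⟩,
      fun hmem => hv'.2 (mem_filter.1 hmem).1⟩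
  rw [card_sdiff_of_subset (h.edgesAt_face_subset hf u), h.card_edgesAt,
    h.card_edgesAt_face f hf u hfu] at h1
  exact h1

end ThreeResonant

/-- every 3-resonant fullerene graph has at most 60 vertices. -/
theorem threeResonant_card_le_sixty {V : Type*} [Fintype V] [DecidableEq V]
    (G : SimpleGraph V) (faces : Finset (Finset (Sym2 V)))
    (hF : IsFullerene G faces) (hres : KResonant G faces 3) :
    Fintype.card V ≤ 60 := by
  classical
  have hE : ∀ e, e ∈ G.edgeSet.toFinset ↔ e ∈ G.edgeSet := fun e => Set.mem_toFinset
  exact ThreeResonant.card_le_sixty (ThreeResonant.isSphericalMap_of_isFullerene hF hE)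
    hF.pentagons (ThreeResonant.exists_adj_pentagon hF hres hE)
end
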